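/- Let d ≥ 3. For every ε > 0 there exists a finite iterated function system of contracting similarities on ℝ^d whose (homogeneous) attractor F_∅ consists of a single point, such that for every condensation set C that is a singleton not equal to F_∅, the lower box dimension of the inhomogeneous attractor F_C is at least d − 1 − ε. -/

import Mathlib

open Filter

/-- The number of cubes from the `δ`-mesh on `ℝ^d` (products of half-open intervals
`[aδ, (a+1)δ)`, `a ∈ ℤ`) that intersect `E`. -/
noncomputable def meshCount (d : ℕ) (δ : ℝ) (E : Set (Fin d → ℝ)) : ℕ :=
  Set.ncard {a : Fin d → ℤ | ∃ x ∈ E, ∀ i, (a i : ℝ) * δ ≤ x i ∧ x i < ((a i : ℝ) + 1) * δ}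

/-- The lower box dimension of `E ⊆ ℝ^d`. -/
noncomputable def lowerBoxDim (d : ℕ) (E : Set (Fin d → ℝ)) : ℝ :=
  liminf (fun δ : ℝ => Real.log (meshCount d δ E) / (-Real.log δ)) (nhdsWithin 0 (Set.Ioi 0))

/-- The Euclidean distance on `ℝ^d` (realised as `Fin d → ℝ`). -/
noncomputable def euclDist (d : ℕ) (x y : Fin d → ℝ) : ℝ :=
  Real.sqrt (∑ i, (x i - y i) ^ 2)

section
open Quaternion

/-- The six integer quaternions `1 ± 2i`, `1 ± 2j`, `1 ± 2k` of norm `5`. -/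
def gen : Fin 6 → ℍ[ℤ] :=
  ![⟨1, 2, 0, 0⟩, ⟨1, -2, 0, 0⟩, ⟨1, 0, 2, 0⟩, ⟨1, 0, -2, 0⟩, ⟨1, 0, 0, 2⟩, ⟨1, 0, 0, -2⟩]

/-- The index of the conjugate generator. -/
def bar : Fin 6 → Fin 6 := ![1, 0, 3, 2, 5, 4]

lemma bar_bar (a : Fin 6) : bar (bar a) = a := by revert a; decide

lemma star_gen (a : Fin 6) : star (gen a) = gen (bar a) := by
  fin_cases a <;> rfl

lemma normSq_gen (a : Fin 6) : normSq (gen a) = 5 := by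
  rw [normSq_def']; fin_cases a <;> rfl

lemma gen_bar_mul_gen (a : Fin 6) : gen (bar a) * gen a = 5 := by
  rw [← star_gen, star_mul_self, normSq_gen]; rfl

/-- A list of letters in which no letter is followed by its conjugate. -/
abbrev Reduced (l : List (Fin 6)) : Prop := l.IsChain (fun a b => b ≠ bar a)

/-- The integer quaternion spelled by a list of letters. -/
def wordProd (l : List (Fin 6)) : ℍ[ℤ] := (l.map gen).prod

@[simp] lemma wordProd_nil : wordProd [] = 1 := rfl

@[simp] lemma wordProd_cons (a : Fin 6) (l : List (Fin 6)) :
    wordProd (a :: l) = gen a * wordProd l := by simp [wordProd]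

lemma wordProd_append (l l' : List (Fin 6)) :
    wordProd (l ++ l') = wordProd l * wordProd l' := by simp [wordProd]

lemma normSq_wordProd (l : List (Fin 6)) : normSq (wordProd l) = 5 ^ l.length := by
  induction l with
  | nil => simp
  | cons a l ih => rw [wordProd_cons, map_mul, ih, normSq_gen, List.length_cons, pow_succ']

lemma star_wordProd (l : List (Fin 6)) :
    star (wordProd l) = wordProd (l.reverse.map bar) := by
  induction l with
  | nil => simp
  | cons a l ih =>
    rw [wordProd_cons, star_mul, ih, star_gen, List.reverse_cons, List.map_append, wordProd_append]
    simp

lemma five_not_dvd_gen_mul {a b : Fin 6} (hab : b ≠ bar a) {z : ℍ[ℤ]}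
    (hz : ¬ (5 : ℍ[ℤ]) ∣ gen b * z) : ¬ (5 : ℍ[ℤ]) ∣ gen a * (gen b * z) := by
  rintro ⟨t, ht⟩
  apply hz
  set s := gen a + gen (bar b) with hs
  have h1 : s * (gen b * z) = 5 * (t + z) := by
    rw [hs, add_mul, ht, ← mul_assoc (gen (bar b)), gen_bar_mul_gen, mul_add]
  have hN : ((normSq s : ℤ) : ℍ[ℤ]) = star s * s := by rw [star_mul_self]; rfl
  have h5 : ∀ w : ℍ[ℤ], w * 5 = 5 * w := fun w => (Nat.cast_commute 5 w).eq.symm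
  have h2 : ((normSq s : ℤ) : ℍ[ℤ]) * (gen b * z) = 5 * (star s * (t + z)) := by
    rw [hN, mul_assoc, h1, ← mul_assoc, ← mul_assoc, h5]
  have h3 : IsCoprime (normSq s) 5 := by
    rw [Int.isCoprime_iff_gcd_eq_one]
    have : ∀ a b : Fin 6, b ≠ bar a → Int.gcd (normSq (gen a + gen (bar b))) 5 = 1 := by
      intro a b hab
      rw [normSq_def']
      revert a b
      decide
    exact this a b hab
  obtain ⟨u, v, huv⟩ := h3
  refine ⟨(u : ℍ[ℤ]) * (star s * (t + z)) + (v : ℍ[ℤ]) * (gen b * z), ?_⟩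
  have h4 : ((u * normSq s + v * 5 : ℤ) : ℍ[ℤ]) = 1 := by rw [huv]; rfl
  calc gen b * z = ((u * normSq s + v * 5 : ℤ) : ℍ[ℤ]) * (gen b * z) := by rw [h4, one_mul]
    _ = (u : ℍ[ℤ]) * (((normSq s : ℤ) : ℍ[ℤ]) * (gen b * z)) + (v : ℍ[ℤ]) * 5 * (gen b * z) := by
      rw [← mul_assoc (u : ℍ[ℤ]), ← add_mul]
      congr 1
      push_cast
      rfl
    _ = _ := by
      rw [h2, ← mul_assoc (u : ℍ[ℤ]) 5, h5, h5, mul_assoc 5 (u : ℍ[ℤ]), mul_assoc 5 (v : ℍ[ℤ]),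
        ← mul_add]

lemma re_five_mul (t : ℍ[ℤ]) : ((5 : ℍ[ℤ]) * t).re = 5 * t.re := by
  have h : (5 : ℍ[ℤ]) * t = 5 • t := by
    rw [nsmul_eq_mul]; rfl
  rw [h, re_smul, nsmul_eq_mul]; rfl

lemma not_five_dvd_gen (a : Fin 6) : ¬ (5 : ℍ[ℤ]) ∣ gen a := by
  rintro ⟨t, ht⟩
  have h : (gen a).re = 5 * t.re := by
    rw [ht, re_five_mul]
  have : (gen a).re = 1 := by fin_cases a <;> rfl
  omega

/-- Reduced words are primitive. -/
lemma Reduced.not_five_dvd {l : List (Fin 6)} (hl : Reduced l) : ¬ (5 : ℍ[ℤ]) ∣ wordProd l := by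
  induction l with
  | nil =>
    rintro ⟨t, ht⟩
    have h : (1 : ℍ[ℤ]).re = 5 * t.re := by
      rw [← wordProd_nil, ht, re_five_mul]
    simp at h
    omega
  | cons a l ih =>
    cases l with
    | nil => simpa using not_five_dvd_gen a
    | cons b l =>
      rw [Reduced, List.isChain_cons_cons] at hl
      have := ih hl.2
      rw [wordProd_cons] at this
      rw [wordProd_cons, wordProd_cons]
      exact five_not_dvd_gen_mul hl.1 this

lemma gen_ne_zero (a : Fin 6) : gen a ≠ 0 := by
  rw [← normSq_ne_zero, normSq_gen]; norm_num

/-- A reduced word is determined by its length and the quaternion it spells. -/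
lemma Reduced.eq_of_wordProd_eq {l l' : List (Fin 6)} (hl : Reduced l) (hl' : Reduced l')
    (hlen : l.length = l'.length) (h : wordProd l = wordProd l') : l = l' := by
  induction l generalizing l' with
  | nil => exact (List.length_eq_zero_iff.1 hlen.symm).symm
  | cons a l ih =>
    cases l' with
    | nil => simp at hlen
    | cons b l' =>
      rw [wordProd_cons, wordProd_cons] at h
      by_cases hab : a = b
      · subst hab
        congr 1
        exact ih hl.tail hl'.tail (by simpa using hlen) (mul_left_cancel₀ (gen_ne_zero a) h)
      · exfalso
        have hred : Reduced (bar a :: b :: l') := by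
          rw [Reduced, List.isChain_cons_cons, bar_bar]
          exact ⟨fun h => hab h.symm, hl'⟩
        apply hred.not_five_dvd
        rw [wordProd_cons, wordProd_cons, ← h, ← mul_assoc, gen_bar_mul_gen]
        exact dvd_mul_right _ _

/-- The reduced words of length `n`. -/
def redWords : ℕ → Finset (List (Fin 6))
  | 0 => {[]}
  | n + 1 => ((Finset.univ ×ˢ redWords n).filter (fun p => Reduced (p.1 :: p.2))).image
      (fun p => p.1 :: p.2)

lemma mem_redWords {n : ℕ} {l : List (Fin 6)} : l ∈ redWords n ↔ l.length = n ∧ Reduced l := by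
  induction n generalizing l with
  | zero => 
    rw [redWords, Finset.mem_singleton]
    constructor
    · rintro rfl; simp
    · rintro ⟨h, -⟩; exact List.length_eq_zero_iff.1 h
  | succ n ih =>
    simp only [redWords, Finset.mem_image, Finset.mem_filter, Finset.mem_product, Finset.mem_univ,
      true_and, ih, Prod.exists]
    constructor
    · rintro ⟨a, l, ⟨⟨h1, h2⟩, h3⟩, rfl⟩
      exact ⟨by simpa using h1, h3⟩
    · rintro ⟨h1, h2⟩
      cases l with
      | nil => simp at h1
      | cons a l => exact ⟨a, l, ⟨⟨by simpa using h1, h2.tail⟩, h2⟩, rfl⟩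

lemma reduced_cons_iff {a : Fin 6} {l : List (Fin 6)} :
    Reduced (a :: l) ↔ l.head? ≠ some (bar a) ∧ Reduced l := by
  cases l <;> simp [Reduced]

lemma sum_redWords_succ {M : Type*} [AddCommMonoid M] (n : ℕ) (f : List (Fin 6) → M) :
    ∑ l ∈ redWords (n + 1), f l =
      ∑ a, ∑ l ∈ (redWords n).filter (fun l => l.head? ≠ some (bar a)), f (a :: l) := by
  rw [redWords, Finset.sum_image (by
    rintro ⟨a, l⟩ _ ⟨b, l'⟩ _ h; simpa using h), Finset.sum_filter, Finset.sum_product]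
  refine Finset.sum_congr rfl fun a _ => ?_
  rw [Finset.sum_filter]
  refine Finset.sum_congr rfl fun l hl => ?_
  have := (mem_redWords.1 hl).2
  simp only [reduced_cons_iff, this, and_true]

/-- For reduced words starting with different letters, `w⁻¹ w'` is again reduced. -/
lemma reduced_reverse_append {a b : Fin 6} {l l' : List (Fin 6)} (hl : Reduced (a :: l))
    (hl' : Reduced (b :: l')) (hab : a ≠ b) :
    Reduced ((a :: l).reverse.map bar ++ b :: l') := by
  have hrev : Reduced ((a :: l).reverse.map bar) := by
    rw [Reduced, List.isChain_map, List.isChain_reverse]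
    refine List.IsChain.imp ?_ hl
    intro c d hcd h
    apply hcd
    simp only [bar_bar] at h
    exact h.symm
  rw [Reduced, List.isChain_append]
  refine ⟨hrev, hl', ?_⟩
  intro x hx y hy
  simp at hx hy
  subst hx hy
  rw [bar_bar]
  exact fun h => hab h.symm

end

section

/-- If two integer points on a circle lie in the same octant, then their second coordinates
differ by at most as much as their first ones. -/
lemma sq_sub_le_of_same_octant {x c d c' d' : ℤ} (h : c ^ 2 + d ^ 2 = x) (h' : c' ^ 2 + d' ^ 2 = x)
    (hcd : |c| ≤ |d|) (hcd' : |c'| ≤ |d'|) (hs : 0 < d ↔ 0 < d') :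
    (d - d') ^ 2 ≤ (c - c') ^ 2 := by
  have key : |d - d'| * (|d| + |d'|) ≤ |c - c'| * (|d| + |d'|) := by
    have h1 : |d - d'| * |d + d'| = |c - c'| * |c + c'| := by
      rw [← abs_mul, ← abs_mul, ← abs_neg]; congr 1; linarith
    have h2 : |d + d'| = |d| + |d'| := by
      rw [abs_add_eq_add_abs_iff]
      by_cases hd : 0 < d
      · left; exact ⟨hd.le, (hs.1 hd).le⟩
      · right; exact ⟨not_lt.1 hd, not_lt.1 fun h => hd (hs.2 h)⟩
    have h3 : |c + c'| ≤ |d| + |d'| := (abs_add_le c c').trans (add_le_add hcd hcd')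
    rw [← h2, h1, h2]
    exact mul_le_mul_of_nonneg_left h3 (abs_nonneg _)
  rw [sq_le_sq]
  rcases (add_nonneg (abs_nonneg d) (abs_nonneg d')).lt_or_eq with hp | hz
  · exact le_of_mul_le_mul_right key hp
  · have hd : d = 0 := abs_eq_zero.1 (by linarith [abs_nonneg d, abs_nonneg d'])
    have hd' : d' = 0 := abs_eq_zero.1 (by linarith [abs_nonneg d, abs_nonneg d'])
    simp [hd, hd']

/-- Three distinct integer points on a circle cannot be too close to each other. -/
lemma four_mul_le_of_three_points {x c₁ d₁ c₂ d₂ c₃ d₃ : ℤ} (hx : 0 < x)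
    (h₁ : c₁ ^ 2 + d₁ ^ 2 = x) (h₂ : c₂ ^ 2 + d₂ ^ 2 = x) (h₃ : c₃ ^ 2 + d₃ ^ 2 = x)
    (h₁₂ : (c₁, d₁) ≠ (c₂, d₂)) (h₁₃ : (c₁, d₁) ≠ (c₃, d₃)) (h₂₃ : (c₂, d₂) ≠ (c₃, d₃)) :
    4 * x ≤ ((c₁ - c₂) ^ 2 + (d₁ - d₂) ^ 2) * ((c₁ - c₃) ^ 2 + (d₁ - d₃) ^ 2) *
      ((c₂ - c₃) ^ 2 + (d₂ - d₃) ^ 2) := by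
  have pos : ∀ {a b c d : ℤ}, (a, b) ≠ (c, d) → 0 < (a - c) ^ 2 + (b - d) ^ 2 := by
    intro a b c d h
    by_contra! hn
    have h1 : a - c = 0 := by nlinarith [sq_nonneg (a - c), sq_nonneg (b - d)]
    have h2 : b - d = 0 := by nlinarith [sq_nonneg (a - c), sq_nonneg (b - d)]
    exact h (by rw [sub_eq_zero.1 h1, sub_eq_zero.1 h2])
  set Δ := (c₂ - c₁) * (d₃ - d₁) - (c₃ - c₁) * (d₂ - d₁) with hΔ
  have key : ((c₁ - c₂) ^ 2 + (d₁ - d₂) ^ 2) * ((c₁ - c₃) ^ 2 + (d₁ - d₃) ^ 2) *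
      ((c₂ - c₃) ^ 2 + (d₂ - d₃) ^ 2) = 4 * x * Δ ^ 2 := by
    have e₁ : d₁ ^ 2 = x - c₁ ^ 2 := by linarith
    have e₂ : d₂ ^ 2 = x - c₂ ^ 2 := by linarith
    have e₃ : d₃ ^ 2 = x - c₃ ^ 2 := by linarith
    have f₁₂ : (c₁ - c₂) ^ 2 + (d₁ - d₂) ^ 2 = 2 * x - 2 * (c₁ * c₂ + d₁ * d₂) := by linarith
    have f₁₃ : (c₁ - c₃) ^ 2 + (d₁ - d₃) ^ 2 = 2 * x - 2 * (c₁ * c₃ + d₁ * d₃) := by linarith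
    have f₂₃ : (c₂ - c₃) ^ 2 + (d₂ - d₃) ^ 2 = 2 * x - 2 * (c₂ * c₃ + d₂ * d₃) := by linarith
    rw [f₁₂, f₁₃, f₂₃, hΔ]
    grind
  have hne : Δ ≠ 0 := by
    intro h0
    have := mul_pos (mul_pos (pos h₁₂) (pos h₁₃)) (pos h₂₃)
    rw [key, h0] at this
    simp at this
  have : 1 ≤ Δ ^ 2 := by have := pow_pos (abs_pos.2 hne) 2; rw [sq_abs] at this; linarith
  rw [key]
  nlinarith [hx]

/-- The circle `c² + d² = x` carries `O(x^(1/3))` integer points. -/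
lemma card_circle_le {x : ℤ} (hx : 1 ≤ x) (T : Finset (ℤ × ℤ))
    (hT : ∀ p ∈ T, p.1 ^ 2 + p.2 ^ 2 = x) : (T.card : ℝ) ≤ 80 * (x : ℝ) ^ (1 / 3 : ℝ) := by
  have hxr : (1 : ℝ) ≤ x := by exact_mod_cast hx
  set y : ℝ := (x : ℝ) ^ (1 / 6 : ℝ) with hy
  have hy1 : 1 ≤ y := Real.one_le_rpow hxr (by norm_num)
  have hy6 : y ^ 6 = x := by
    rw [hy, ← Real.rpow_natCast, ← Real.rpow_mul (by linarith)]; norm_num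
  have hy2 : (x : ℝ) ^ (1 / 3 : ℝ) = y ^ 2 := by
    rw [hy, ← Real.rpow_natCast, ← Real.rpow_mul (by linarith)]; norm_num
  set t : ℤ := ⌊y / 2⌋ with ht
  have ht0 : 0 ≤ t := Int.floor_nonneg.2 (by linarith)
  have hty : (t : ℝ) ≤ y / 2 := Int.floor_le _
  have hty' : y / 2 < t + 1 := Int.lt_floor_add_one _
  set K : ℤ := ⌊2 * y ^ 2⌋ with hK
  let key : ℤ × ℤ → Bool × Bool × ℤ := fun p =>
    if |p.1| ≤ |p.2| then (true, decide (0 < p.2), p.1 / (t + 1))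
    else (false, decide (0 < p.1), p.2 / (t + 1))
  have hdiv : ∀ c d : ℤ, c ^ 2 + d ^ 2 = x → c / (t + 1) ∈ Finset.Icc (-K - 1) K := by
    intro c d h
    have hc : (c : ℝ) ^ 2 ≤ (y ^ 3) ^ 2 := by
      rw [← pow_mul]; norm_num; rw [hy6]
      have : c ^ 2 ≤ x := by nlinarith [sq_nonneg d]
      exact_mod_cast this
    have hc' := abs_le.1 (abs_le_of_sq_le_sq hc (by positivity))
    have ht1 : (0 : ℝ) < t + 1 := by linarith
    have h2 : y ^ 3 ≤ 2 * y ^ 2 * (t + 1) := by nlinarith [sq_nonneg y]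
    rw [Finset.mem_Icc]
    constructor
    · rw [Int.le_ediv_iff_mul_le (by linarith)]
      have h3 : 2 * y ^ 2 < K + 1 := Int.lt_floor_add_one _
      have : ((-K - 1 : ℤ) * (t + 1) : ℝ) ≤ c := by push_cast; nlinarith
      exact_mod_cast this
    · have h4 : (t + 1) * (c / (t + 1)) ≤ c := Int.mul_ediv_self_le (by linarith)
      have h4' : ((t : ℝ) + 1) * ((c / (t + 1) : ℤ) : ℝ) ≤ c := by exact_mod_cast h4
      apply Int.le_floor.2
      nlinarith
  have himg : T.image key ⊆ Finset.univ ×ˢ (Finset.univ ×ˢ Finset.Icc (-K - 1) K) := by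
    intro b hb
    obtain ⟨p, hp, rfl⟩ := Finset.mem_image.1 hb
    simp only [Finset.mem_product, Finset.mem_univ, true_and, key]
    split_ifs
    · exact hdiv _ _ (hT p hp)
    · exact hdiv p.2 p.1 (by rw [add_comm]; exact hT p hp)
  have hclose : ∀ a b : ℤ, a / (t + 1) = b / (t + 1) → (a - b) ^ 2 ≤ t ^ 2 := by
    intro a b h
    have h1 := Int.emod_add_mul_ediv a (t + 1)
    have h2 := Int.emod_add_mul_ediv b (t + 1)
    have h3 := Int.emod_nonneg a (show t + 1 ≠ 0 by linarith)
    have h4 := Int.emod_nonneg b (show t + 1 ≠ 0 by linarith)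
    have h5 := Int.emod_lt_of_pos a (show 0 < t + 1 by linarith)
    have h6 := Int.emod_lt_of_pos b (show 0 < t + 1 by linarith)
    rw [h] at h1
    rw [sq_le_sq, abs_of_nonneg ht0, abs_le]
    constructor <;> linarith
  have hdist : ∀ p ∈ T, ∀ q ∈ T, key p = key q →
      (p.1 - q.1) ^ 2 + (p.2 - q.2) ^ 2 ≤ 2 * t ^ 2 := by
    intro p hp q hq h
    simp only [key] at h
    have hTp := hT p hp
    have hTq := hT q hq
    split_ifs at h with h1 h2 h2
    · simp only [Prod.mk.injEq, true_and, decide_eq_decide] at h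
      linarith [hclose _ _ h.2, sq_sub_le_of_same_octant hTp hTq h1 h2 h.1]
    · simp at h
    · simp at h
    · simp only [Prod.mk.injEq, true_and, decide_eq_decide] at h
      linarith [hclose _ _ h.2, sq_sub_le_of_same_octant ((add_comm _ _).trans hTp)
        ((add_comm _ _).trans hTq) (not_le.1 h1).le (not_le.1 h2).le h.1]
  have hfib : ∀ b ∈ T.image key, (T.filter (fun p => key p = b)).card ≤ 2 := by
    intro b _
    by_contra! hlt
    obtain ⟨p, hp, q, hq, r, hr, hpq, hpr, hqr⟩ := Finset.two_lt_card.1 hlt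
    rw [Finset.mem_filter] at hp hq hr
    have h4 := four_mul_le_of_three_points (by linarith) (hT p hp.1) (hT q hq.1) (hT r hr.1)
      hpq hpr hqr
    have d1 := hdist p hp.1 q hq.1 (hp.2.trans hq.2.symm)
    have d2 := hdist p hp.1 r hr.1 (hp.2.trans hr.2.symm)
    have d3 := hdist q hq.1 r hr.1 (hq.2.trans hr.2.symm)
    have h5 : 4 * x ≤ (2 * t ^ 2) * (2 * t ^ 2) * (2 * t ^ 2) :=
      h4.trans (mul_le_mul (mul_le_mul d1 d2 (by positivity) (by positivity)) d3 (by positivity)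
        (by positivity))
    have h6 : (4 * x : ℝ) ≤ 8 * (t : ℝ) ^ 6 := by
      have : 4 * x ≤ 8 * t ^ 6 := by linarith
      exact_mod_cast this
    have h7 : (t : ℝ) ^ 6 ≤ (y / 2) ^ 6 := pow_le_pow_left₀ (by exact_mod_cast ht0) hty 6
    rw [div_pow, hy6] at h7
    linarith
  have hcard := (Finset.card_le_mul_card_image T 2 hfib).trans
    (Nat.mul_le_mul_left 2 (Finset.card_le_card himg))
  have hK0 : 0 ≤ K := Int.floor_nonneg.2 (by positivity)
  have hKy : (K : ℝ) ≤ 2 * y ^ 2 := Int.floor_le _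
  simp only [Finset.card_product, Finset.card_univ, Fintype.card_bool, Int.card_Icc] at hcard
  have hz : ((K + 1 - (-K - 1)).toNat : ℝ) = 2 * K + 2 := by
    have : (((K + 1 - (-K - 1)).toNat : ℤ) : ℝ) = 2 * K + 2 := by
      rw [Int.toNat_of_nonneg (by linarith)]; push_cast; ring
    exact_mod_cast this
  have hcr : (T.card : ℝ) ≤ 2 * (2 * (2 * ((K + 1 - (-K - 1)).toNat : ℝ))) := by exact_mod_cast hcard
  rw [hz] at hcr
  rw [hy2]
  nlinarith

/-- The sphere `b² + c² + d² = x` carries `O(x^(5/6))` integer points. -/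
lemma card_sphere_le {x : ℤ} (hx : 1 ≤ x) (T : Finset (ℤ × ℤ × ℤ))
    (hT : ∀ p ∈ T, p.1 ^ 2 + p.2.1 ^ 2 + p.2.2 ^ 2 = x) :
    (T.card : ℝ) ≤ 240 * (x : ℝ) ^ (5 / 6 : ℝ) := by
  have hxr : (1 : ℝ) ≤ x := by exact_mod_cast hx
  set L : ℤ := ⌊Real.sqrt x⌋ with hL
  have hL0 : 0 ≤ L := Int.floor_nonneg.2 (Real.sqrt_nonneg _)
  have hLx : (L : ℝ) ≤ Real.sqrt x := Int.floor_le _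
  have hmaps : ∀ p ∈ T, p.1 ∈ Finset.Icc (-L) L := by
    intro p hp
    have h := hT p hp
    have h1 : p.1 ^ 2 ≤ x := by nlinarith [sq_nonneg p.2.1, sq_nonneg p.2.2]
    have h2 : |(p.1 : ℝ)| ≤ Real.sqrt x := by
      apply Real.abs_le_sqrt; exact_mod_cast h1
    rw [Finset.mem_Icc, ← abs_le]
    apply Int.le_floor.2
    exact_mod_cast h2
  have hfib : ∀ b ∈ Finset.Icc (-L) L,
      ((T.filter (fun p => p.1 = b)).card : ℝ) ≤ 80 * (x : ℝ) ^ (1 / 3 : ℝ) := by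
    intro b _
    have hinj : Set.InjOn Prod.snd (T.filter (fun p => p.1 = b) : Set (ℤ × ℤ × ℤ)) := by
      intro p hp q hq h
      simp only [Finset.coe_filter, Set.mem_ofPred_eq] at hp hq
      exact Prod.ext (hp.2.trans hq.2.symm) h
    rw [← Finset.card_image_of_injOn hinj]
    have hmem : ∀ p ∈ (T.filter (fun p => p.1 = b)).image Prod.snd,
        p.1 ^ 2 + p.2 ^ 2 = x - b ^ 2 := by
      intro p hp
      obtain ⟨q, hq, rfl⟩ := Finset.mem_image.1 hp
      rw [Finset.mem_filter] at hq
      rw [← hq.2]; linarith [hT q hq.1]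
    rcases lt_or_ge 0 (x - b ^ 2) with hpos | hneg
    · refine (card_circle_le (by linarith) _ hmem).trans ?_
      have h1 : ((x - b ^ 2 : ℤ) : ℝ) ≤ x := by push_cast; nlinarith [sq_nonneg (b : ℝ)]
      have h2 : (0 : ℝ) ≤ ((x - b ^ 2 : ℤ) : ℝ) := by exact_mod_cast hpos.le
      exact mul_le_mul_of_nonneg_left (Real.rpow_le_rpow h2 h1 (by norm_num)) (by norm_num)
    · have hsub : (T.filter (fun p => p.1 = b)).image Prod.snd ⊆ {(0, 0)} := by
        intro p hp
        have h := hmem p hp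
        have h1 : p.1 = 0 := by nlinarith [sq_nonneg p.1, sq_nonneg p.2]
        have h2 : p.2 = 0 := by nlinarith [sq_nonneg p.1, sq_nonneg p.2]
        rw [Finset.mem_singleton]; exact Prod.ext h1 h2
      have h1 : ((((T.filter (fun p => p.1 = b)).image Prod.snd).card : ℕ) : ℝ) ≤ 1 := by
        exact_mod_cast Finset.card_le_card hsub
      have h2 : (1 : ℝ) ≤ (x : ℝ) ^ (1 / 3 : ℝ) := Real.one_le_rpow hxr (by norm_num)
      linarith
  have hcard : (T.card : ℝ) = ∑ b ∈ Finset.Icc (-L) L, ((T.filter (fun p => p.1 = b)).card : ℝ) := by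
    exact_mod_cast Finset.card_eq_sum_card_fiberwise hmaps
  rw [hcard]
  refine (Finset.sum_le_sum hfib).trans ?_
  rw [Finset.sum_const, Int.card_Icc, nsmul_eq_mul]
  have hz : ((L + 1 - -L).toNat : ℝ) = 2 * L + 1 := by
    have : (((L + 1 - -L).toNat : ℤ) : ℝ) = 2 * L + 1 := by
      rw [Int.toNat_of_nonneg (by linarith)]; push_cast; ring
    exact_mod_cast this
  have h56 : (x : ℝ) ^ (5 / 6 : ℝ) = Real.sqrt x * (x : ℝ) ^ (1 / 3 : ℝ) := by
    rw [Real.sqrt_eq_rpow, ← Real.rpow_add (by linarith)]; norm_num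
  have hs1 : 1 ≤ Real.sqrt x := Real.one_le_sqrt.2 hxr
  have hp : 0 ≤ (x : ℝ) ^ (1 / 3 : ℝ) := by positivity
  rw [hz, h56]
  nlinarith

end

section
open Polynomial

lemma U_mul_U_natCast (i : ℤ) (j : ℕ) :
    Chebyshev.U ℝ i * Chebyshev.U ℝ j =
      ∑ l ∈ Finset.range (j + 1), Chebyshev.U ℝ (i + j - 2 * l) := by
  induction j using Nat.twoStepInduction with
  | zero => simp
  | one =>
    simp only [Nat.cast_one, Chebyshev.U_one, Finset.sum_range_succ, Finset.sum_range_zero]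
    have := Chebyshev.U_add_two ℝ (i - 1)
    rw [show i - 1 + 2 = i + 1 by ring, show i - 1 + 1 = i by ring] at this
    push_cast
    rw [sub_zero, show i + 1 - 2 = i - 1 by ring, this]
    ring
  | more j ih1 ih2 =>
    have hX : ∀ n : ℤ, 2 * X * Chebyshev.U ℝ n =
        Chebyshev.U ℝ (n + 1) + Chebyshev.U ℝ (n - 1) := fun n => by
      have := Chebyshev.U_add_two ℝ (n - 1)
      rw [show n - 1 + 2 = n + 1 by ring, show n - 1 + 1 = n by ring] at this
      rw [this]; ring
    have h := Chebyshev.U_add_two ℝ (j : ℤ)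
    push_cast at ih2 ⊢
    rw [h, mul_sub, ih1, ← mul_assoc, mul_comm (Chebyshev.U ℝ i), mul_assoc, ih2, Finset.mul_sum,
      Finset.sum_range_succ _ (j + 1 + 1)]
    simp only [hX, Finset.sum_add_distrib]
    rw [Finset.sum_range_succ _ (j + 1), Finset.sum_range_succ _ (j + 1),
      Finset.sum_range_succ _ (j + 1)]
    have e1 : ∀ l : ℕ, i + ((j : ℤ) + 1) - 2 * l - 1 = i + j - 2 * l := fun l => by ring
    have e2 : ∀ l : ℕ, i + ((j : ℤ) + 1) - 2 * l + 1 = i + (j + 2) - 2 * l := fun l => by ring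
    simp only [e1, e2]
    have e3 : i + ((j : ℤ) + 2) - 2 * ((j + 1 + 1 : ℕ) : ℤ) = i + j - 2 * ((j + 1 : ℕ) : ℤ) := by
      push_cast; ring
    rw [e3]
    ring

lemma U_two_mul_mul_U_two_mul {i j : ℕ} (hij : j ≤ i) :
    Chebyshev.U ℝ (2 * i : ℕ) * Chebyshev.U ℝ (2 * j : ℕ) =
      ∑ m ∈ Finset.Icc (i - j) (i + j), Chebyshev.U ℝ (2 * m : ℕ) := by
  rw [U_mul_U_natCast]
  refine Finset.sum_bij' (fun l _ => i + j - l) (fun m _ => i + j - m) ?_ ?_ ?_ ?_ ?_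
  · intro l hl; simp at hl ⊢; omega
  · intro l hl; simp at hl ⊢; omega
  · intro l hl; simp at hl ⊢; omega
  · intro l hl; simp at hl ⊢; omega
  · intro l hl
    congr 1
    simp at hl
    omega

lemma U_sq (M : ℕ) :
    Chebyshev.U ℝ (M : ℕ) ^ 2 = ∑ j ∈ Finset.range (M + 1), Chebyshev.U ℝ (2 * j : ℕ) := by
  rw [sq, U_mul_U_natCast, ← Finset.sum_range_reflect]
  refine Finset.sum_congr rfl fun l hl => ?_
  congr 1
  simp at hl
  omega

/-- The coefficient of `U_{2m}` in `U_M ^ 4`. -/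
def coeffU (M m : ℕ) : ℕ :=
  ((Finset.range (M + 1) ×ˢ Finset.range (M + 1)).filter
    (fun p => p.1 - p.2 ≤ m ∧ p.2 - p.1 ≤ m ∧ m ≤ p.1 + p.2)).card

lemma U_pow_four (M : ℕ) :
    Chebyshev.U ℝ (M : ℕ) ^ 4 =
      ∑ m ∈ Finset.range (2 * M + 1), (coeffU M m : ℝ[X]) * Chebyshev.U ℝ (2 * m : ℕ) := by
  have h : Chebyshev.U ℝ (M : ℕ) ^ 4 = ∑ p ∈ Finset.range (M + 1) ×ˢ Finset.range (M + 1),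
      Chebyshev.U ℝ (2 * p.1 : ℕ) * Chebyshev.U ℝ (2 * p.2 : ℕ) := by
    rw [show Chebyshev.U ℝ (M : ℕ) ^ 4 = Chebyshev.U ℝ (M : ℕ) ^ 2 * Chebyshev.U ℝ (M : ℕ) ^ 2 by
      ring, U_sq, Finset.sum_mul_sum, Finset.sum_product]
  have h2 : ∀ p ∈ Finset.range (M + 1) ×ˢ Finset.range (M + 1),
      Chebyshev.U ℝ (2 * p.1 : ℕ) * Chebyshev.U ℝ (2 * p.2 : ℕ) =
      ∑ m ∈ Finset.range (2 * M + 1), if p.1 - p.2 ≤ m ∧ p.2 - p.1 ≤ m ∧ m ≤ p.1 + p.2 then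
        Chebyshev.U ℝ (2 * m : ℕ) else 0 := by
    intro p hp
    simp at hp
    rw [← Finset.sum_filter]
    rcases le_total p.2 p.1 with hle | hle
    · rw [U_two_mul_mul_U_two_mul hle]
      refine Finset.sum_congr ?_ fun _ _ => rfl
      ext m; simp; omega
    · rw [mul_comm, U_two_mul_mul_U_two_mul hle]
      refine Finset.sum_congr ?_ fun _ _ => rfl
      ext m; simp; omega
  rw [h, Finset.sum_congr rfl h2, Finset.sum_comm]
  refine Finset.sum_congr rfl fun m _ => ?_
  rw [← Finset.sum_filter, Finset.sum_const, coeffU, nsmul_eq_mul]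

lemma coeffU_zero (M : ℕ) : coeffU M 0 = M + 1 := by
  rw [coeffU]
  have : ((Finset.range (M + 1) ×ˢ Finset.range (M + 1)).filter
      (fun p => p.1 - p.2 ≤ 0 ∧ p.2 - p.1 ≤ 0 ∧ 0 ≤ p.1 + p.2)) =
      (Finset.range (M + 1)).image (fun i => (i, i)) := by
    ext ⟨i, j⟩; simp; omega
  rw [this, Finset.card_image_of_injective _ (fun i j h => by simpa using h), Finset.card_range]

lemma sq_le_two_mul_coeffU (M : ℕ) : M ^ 2 ≤ 2 * coeffU M M := by
  have h : ((Finset.range (M + 1)).sigma (fun i => Finset.Icc (M - i) M)).card =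
      ∑ i ∈ Finset.range (M + 1), (i + 1) := by
    rw [Finset.card_sigma]
    refine Finset.sum_congr rfl fun i hi => ?_
    simp at hi ⊢; omega
  have h2 : ((Finset.range (M + 1)).sigma (fun i => Finset.Icc (M - i) M)).card ≤ coeffU M M := by
    rw [coeffU]
    refine Finset.card_le_card_of_injOn (fun p => (p.1, p.2)) ?_ ?_
    · intro p hp; simp at hp ⊢; omega
    · rintro ⟨i, j⟩ _ ⟨i', j'⟩ _ h; simpa using h
  rw [h] at h2
  have h3 := Finset.sum_range_id_mul_two (M + 2)
  rw [Finset.sum_range_succ'] at h3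
  simp only [add_zero] at h3
  have h4 : (M + 2) * (M + 2 - 1) = M ^ 2 + 3 * M + 2 := by
    rw [show M + 2 - 1 = M + 1 by omega]; ring
  rw [h4] at h3
  linarith

lemma sum_coeffU (M : ℕ) :
    ∑ m ∈ Finset.range (2 * M + 1), (coeffU M m : ℝ) * (2 * m + 1) = ((M : ℝ) + 1) ^ 4 := by
  have h := congrArg (eval 1) (U_pow_four M)
  simp only [eval_pow, Chebyshev.U_eval_one, eval_finsetSum, eval_mul, eval_natCast] at h
  push_cast at h
  exact h.symm

lemma abs_sin_nat_mul_le (n : ℕ) (t : ℝ) : |Real.sin (n * t)| ≤ n * |Real.sin t| := by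
  induction n with
  | zero => simp
  | succ n ih =>
    push_cast
    rw [add_mul, one_mul, Real.sin_add]
    calc _ ≤ |Real.sin (n * t)| * |Real.cos t| + |Real.cos (n * t)| * |Real.sin t| := by
          rw [← abs_mul, ← abs_mul]; exact abs_add_le _ _
      _ ≤ n * |Real.sin t| * 1 + 1 * |Real.sin t| := by
          gcongr
          · exact Real.abs_cos_le_one _
          · exact Real.abs_cos_le_one _
      _ = _ := by ring

/-- The kernel `U_M ^ 4`. -/
noncomputable def kerU (M : ℕ) (x : ℝ) : ℝ := (Chebyshev.U ℝ (M : ℕ)).eval x ^ 4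

lemma kerU_nonneg (M : ℕ) (x : ℝ) : 0 ≤ kerU M x := by
  rw [kerU]; positivity

lemma kerU_le {M : ℕ} {x : ℝ} (hx : |x| ≤ 1) : kerU M x ≤ ((M : ℝ) + 1) ^ 4 := by
  obtain ⟨t, rfl⟩ : ∃ t, x = Real.cos t :=
    ⟨_, (Real.cos_arccos (abs_le.1 hx).1 (abs_le.1 hx).2).symm⟩
  have h : |(Chebyshev.U ℝ (M : ℕ)).eval (Real.cos t)| ≤ (M : ℝ) + 1 := by
    by_cases hs : Real.sin t = 0
    · have h1 : Real.cos t = 1 ∨ Real.cos t = -1 := by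
        have := Real.sin_sq_add_cos_sq t
        rw [hs] at this
        have : (Real.cos t - 1) * (Real.cos t + 1) = 0 := by linarith
        rcases mul_eq_zero.1 this with h | h
        · left; linarith
        · right; linarith
      rcases h1 with h1 | h1
      · rw [h1, Chebyshev.U_eval_one]
        push_cast
        rw [abs_of_nonneg (by positivity)]
      · rw [h1, Chebyshev.U_eval_neg_one]
        rw [abs_mul]
        have : |(((Int.negOnePow (M : ℤ) : ℤˣ) : ℤ) : ℝ)| = 1 := by
          rcases Int.units_eq_one_or (Int.negOnePow (M : ℤ)) with h | h <;> rw [h] <;> simp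
        rw [this]
        push_cast
        rw [abs_of_nonneg (by positivity)]
        simp
    · have h1 := Chebyshev.U_real_cos t (M : ℕ)
      have h2 := abs_sin_nat_mul_le (M + 1) t
      push_cast at h1 h2
      rw [← h1, abs_mul] at h2
      exact le_of_mul_le_mul_right h2 (abs_pos.2 hs)
  rw [kerU, ← (show Even 4 by decide).pow_abs]
  gcongr

lemma kerU_mul_le {M : ℕ} {x : ℝ} (hx : |x| ≤ 1) : kerU M x * (1 - x ^ 2) ^ 2 ≤ 1 := by
  obtain ⟨t, rfl⟩ : ∃ t, x = Real.cos t :=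
    ⟨_, (Real.cos_arccos (abs_le.1 hx).1 (abs_le.1 hx).2).symm⟩
  have h1 := Chebyshev.U_real_cos t (M : ℕ)
  rw [kerU, ← Real.sin_sq, ← pow_mul, ← mul_pow, h1]
  have := Real.sin_sq_le_one ((((M : ℕ) : ℤ) + 1 : ℝ) * t)
  calc _ = (Real.sin ((((M : ℕ) : ℤ) + 1 : ℝ) * t) ^ 2) ^ 2 := by ring
    _ ≤ 1 := pow_le_one₀ (sq_nonneg _) this

lemma kerU_eq_sum (M : ℕ) (x : ℝ) : kerU M x =
    ∑ m ∈ Finset.range (2 * M + 1), (coeffU M m : ℝ) * (Chebyshev.U ℝ (2 * m : ℕ)).eval x := by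
  rw [kerU, ← eval_pow, U_pow_four]
  simp [eval_finsetSum]

end

section
open Quaternion

lemma five_rpow_le : (5 : ℝ) ^ (17 / 6 : ℝ) ≤ 96 := by
  have h : (5 : ℝ) ^ (17 / 6 : ℝ) = ((5 : ℝ) ^ 17) ^ ((6 : ℕ) : ℝ)⁻¹ := by
    rw [← Real.rpow_natCast 5 17, ← Real.rpow_mul (by norm_num)]; norm_num
  rw [h, Real.rpow_inv_le_iff_of_pos (by norm_num) (by norm_num) (by norm_num)]
  rw [Real.rpow_natCast]; norm_num

lemma sum_rpow_neg_le {s : Finset ℤ} (f : ℤ → ℤ) (hf : Set.InjOn f s) (hpos : ∀ a ∈ s, 0 < f a) :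
    ∑ a ∈ s, ((f a : ℤ) : ℝ) ^ (-(7 / 6) : ℝ) ≤ ∑' n : ℕ, (n : ℝ) ^ (-(7 / 6) : ℝ) := by
  have h : ∑ a ∈ s, ((f a : ℤ) : ℝ) ^ (-(7 / 6) : ℝ) =
      ∑ n ∈ s.image (fun a => (f a).toNat), (n : ℝ) ^ (-(7 / 6) : ℝ) := by
    rw [Finset.sum_image]
    · refine Finset.sum_congr rfl fun a ha => ?_
      congr 1
      have := Int.toNat_of_nonneg (hpos a ha).le
      exact_mod_cast congrArg (Int.cast : ℤ → ℝ) this.symm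
    · intro a ha b hb hab
      have h1 := Int.toNat_of_nonneg (hpos a ha).le
      have h2 := Int.toNat_of_nonneg (hpos b hb).le
      refine hf ha hb ?_
      simp only at hab
      omega
  rw [h]
  refine Summable.sum_le_tsum _ (fun n _ => by positivity) ?_
  rw [Real.summable_nat_rpow]; norm_num

/-- The imaginary part of an integer quaternion as a triple. -/
def imTriple (r : ℍ[ℤ]) : ℤ × ℤ × ℤ := (r.imI, r.imJ, r.imK)

lemma card_normSq_re_le {x a N : ℤ} (hx : 1 ≤ x) (T : Finset ℍ[ℤ])
    (hT : ∀ r ∈ T, normSq r = N ∧ r.re = a) (hxa : x = N - a ^ 2) :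
    (T.card : ℝ) ≤ 240 * (x : ℝ) ^ (5 / 6 : ℝ) := by
  classical
  have hinj : Set.InjOn imTriple T := by
    intro r hr r' hr' h
    simp only [imTriple, Prod.mk.injEq] at h
    exact QuaternionAlgebra.ext ((hT r hr).2.trans (hT r' hr').2.symm) h.1 h.2.1 h.2.2
  rw [← Finset.card_image_of_injOn hinj]
  refine card_sphere_le hx _ fun p hp => ?_
  obtain ⟨r, hr, rfl⟩ := Finset.mem_image.1 hp
  obtain ⟨h1, h2⟩ := hT r hr
  rw [normSq_def'] at h1
  simp only [imTriple]
  rw [hxa, ← h1, ← h2]; ring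

lemma sum_kerU_fiber_le {n M : ℕ} {a : ℤ} (ha : |a| < 5 ^ n) (T : Finset ℍ[ℤ])
    (hT : ∀ r ∈ T, normSq r = 25 ^ n ∧ r.re = a) :
    ∑ r ∈ T, kerU M ((r.re : ℝ) / 5 ^ n) ≤
      240 * 96 ^ n * (((5 ^ n - |a| : ℤ) : ℝ) ^ (-(7 / 6) : ℝ)) := by
  set Y : ℝ := 5 ^ n with hY
  have hYpos : 0 < Y := by positivity
  have haY : |(a : ℝ)| < Y := by
    rw [hY]; exact_mod_cast ha
  have hx1 : (1 : ℤ) ≤ 25 ^ n - a ^ 2 := by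
    have : a ^ 2 < (5 ^ n) ^ 2 := by rw [← sq_abs]; gcongr
    rw [← pow_mul, mul_comm, pow_mul] at this
    norm_num at this
    omega
  have hcard := card_normSq_re_le hx1 T hT rfl
  have hxc : (((25 ^ n - a ^ 2 : ℤ)) : ℝ) = Y ^ 2 - a ^ 2 := by
    push_cast; rw [hY, ← pow_mul, mul_comm, pow_mul]; norm_num
  rw [hxc] at hcard
  set x : ℝ := Y ^ 2 - (a : ℝ) ^ 2 with hx
  have hxpos : 0 < x := by rw [hx, ← sq_abs (a : ℝ)]; nlinarith [abs_nonneg (a : ℝ)]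
  set s : ℝ := ((5 ^ n - |a| : ℤ) : ℝ) with hs
  have hs' : s = Y - |(a : ℝ)| := by rw [hs, hY]; push_cast; rfl
  have hspos : 0 < s := by rw [hs']; linarith
  have hxs : s * Y ≤ x := by
    rw [hs', hx, ← sq_abs (a : ℝ)]; nlinarith [abs_nonneg (a : ℝ)]
  have hker : ∀ r ∈ T, kerU M ((r.re : ℝ) / Y) ≤ Y ^ 4 / x ^ 2 := by
    intro r hr
    rw [(hT r hr).2]
    have h1 : |(a : ℝ) / Y| ≤ 1 := by
      rw [abs_div, abs_of_pos hYpos, div_le_one hYpos]; exact haY.le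
    have h2 := kerU_mul_le (M := M) h1
    have h3 : (1 - ((a : ℝ) / Y) ^ 2) = x / Y ^ 2 := by rw [hx]; field_simp
    rw [h3, div_pow, ← pow_mul] at h2
    rw [le_div_iff₀ (by positivity)]
    rw [mul_div_assoc', div_le_one (by positivity)] at h2
    exact h2
  calc ∑ r ∈ T, kerU M ((r.re : ℝ) / Y) ≤ T.card * (Y ^ 4 / x ^ 2) := by
        rw [← nsmul_eq_mul]; exact Finset.sum_le_card_nsmul _ _ _ hker
    _ ≤ 240 * x ^ (5 / 6 : ℝ) * (Y ^ 4 / x ^ 2) := by gcongr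
    _ = 240 * Y ^ 4 * x ^ (-(7 / 6) : ℝ) := by
        rw [show (-(7 / 6) : ℝ) = 5 / 6 - (2 : ℕ) by norm_num, Real.rpow_sub hxpos,
          Real.rpow_natCast]; ring
    _ ≤ 240 * Y ^ 4 * (s * Y) ^ (-(7 / 6) : ℝ) := by
        gcongr 240 * Y ^ 4 * ?_
        exact Real.rpow_le_rpow_of_nonpos (by positivity) hxs (by norm_num)
    _ = 240 * Y ^ (17 / 6 : ℝ) * s ^ (-(7 / 6) : ℝ) := by
        rw [Real.mul_rpow hspos.le hYpos.le,
          show (17 / 6 : ℝ) = (4 : ℕ) + -(7 / 6) by norm_num, Real.rpow_add hYpos,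
          Real.rpow_natCast]; ring
    _ ≤ 240 * 96 ^ n * s ^ (-(7 / 6) : ℝ) := by
        gcongr
        rw [hY, ← Real.rpow_natCast, ← Real.rpow_mul (by norm_num), mul_comm,
          Real.rpow_mul (by norm_num), Real.rpow_natCast]
        exact pow_le_pow_left₀ (by positivity) five_rpow_le n

lemma sum_kerU_pole_le {n M : ℕ} {a : ℤ} (ha : |a| = 5 ^ n) (T : Finset ℍ[ℤ])
    (hT : ∀ r ∈ T, normSq r = 25 ^ n ∧ r.re = a) :
    ∑ r ∈ T, kerU M ((r.re : ℝ) / 5 ^ n) ≤ ((M : ℝ) + 1) ^ 4 := by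
  have hcard : T.card ≤ 1 := by
    rw [Finset.card_le_one]
    have key : ∀ r ∈ T, r.imI = 0 ∧ r.imJ = 0 ∧ r.imK = 0 := by
      intro r hr
      obtain ⟨h1, h2⟩ := hT r hr
      rw [normSq_def', h2, ← sq_abs a, ha, ← pow_mul, mul_comm, pow_mul] at h1
      norm_num at h1
      have : r.imI ^ 2 + r.imJ ^ 2 + r.imK ^ 2 = 0 := by linarith
      refine ⟨?_, ?_, ?_⟩ <;> apply pow_eq_zero_iff (two_ne_zero) |>.1 <;>
        nlinarith [sq_nonneg r.imI, sq_nonneg r.imJ, sq_nonneg r.imK]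
    intro r hr r' hr'
    obtain ⟨h1, h2, h3⟩ := key r hr
    obtain ⟨h1', h2', h3'⟩ := key r' hr'
    exact QuaternionAlgebra.ext ((hT r hr).2.trans (hT r' hr').2.symm) (h1.trans h1'.symm)
      (h2.trans h2'.symm) (h3.trans h3'.symm)
  have hker : ∀ r ∈ T, kerU M ((r.re : ℝ) / 5 ^ n) ≤ ((M : ℝ) + 1) ^ 4 := by
    intro r hr
    apply kerU_le
    rw [(hT r hr).2, abs_div, abs_of_pos (by positivity : (0 : ℝ) < 5 ^ n),
      div_le_one (by positivity)]
    exact_mod_cast ha.le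
  calc _ ≤ T.card • ((M : ℝ) + 1) ^ 4 := Finset.sum_le_card_nsmul _ _ _ hker
    _ ≤ 1 • ((M : ℝ) + 1) ^ 4 := by gcongr
    _ = _ := one_smul _ _

/-- The average of the kernel over integer quaternions of norm `25 ^ n`. -/
lemma exists_sum_kerU_le : ∃ C : ℝ, 0 < C ∧ ∀ (n M : ℕ) (T : Finset ℍ[ℤ]),
    (∀ r ∈ T, normSq r = 25 ^ n) →
    ∑ r ∈ T, kerU M ((r.re : ℝ) / 5 ^ n) ≤ 2 * ((M : ℝ) + 1) ^ 4 + C * 96 ^ n := by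
  classical
  set Z := ∑' n : ℕ, (n : ℝ) ^ (-(7 / 6) : ℝ) with hZ
  have hZ0 : 0 ≤ Z := tsum_nonneg fun n => by positivity
  refine ⟨480 * Z + 1, by positivity, fun n M T hT => ?_⟩
  have habs : ∀ r ∈ T, r.re ∈ Finset.Icc (-(5 ^ n) : ℤ) (5 ^ n) := by
    intro r hr
    have h := hT r hr
    rw [normSq_def'] at h
    rw [Finset.mem_Icc, ← abs_le]
    apply abs_le_of_sq_le_sq _ (by positivity)
    rw [← pow_mul, mul_comm n, pow_mul]
    norm_num
    nlinarith [sq_nonneg r.imI, sq_nonneg r.imJ, sq_nonneg r.imK]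
  rw [← Finset.sum_fiberwise_of_maps_to habs]
  have hfib : ∀ a, ∀ r ∈ T.filter (fun r => r.re = a), normSq r = 25 ^ n ∧ r.re = a := by
    intro a r hr
    rw [Finset.mem_filter] at hr
    exact ⟨hT r hr.1, hr.2⟩
  have hIcc : Finset.Icc (-(5 ^ n) : ℤ) (5 ^ n) =
      insert (-(5 ^ n)) (insert (5 ^ n) (Finset.Ioo (-(5 ^ n)) (5 ^ n))) := by
    ext a
    have : (0 : ℤ) < 5 ^ n := by positivity
    simp only [Finset.mem_Icc, Finset.mem_insert, Finset.mem_Ioo]; omega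
  have hY : (0 : ℤ) < 5 ^ n := by positivity
  rw [hIcc, Finset.sum_insert (by simp only [Finset.mem_insert, Finset.mem_Ioo]; omega), Finset.sum_insert (by simp)]
  have h1 := sum_kerU_pole_le (M := M) (n := n) (a := -(5 ^ n)) (by rw [abs_neg, abs_of_pos hY])
    _ (hfib _)
  have h2 := sum_kerU_pole_le (M := M) (n := n) (a := 5 ^ n) (abs_of_pos hY) _ (hfib _)
  have h3 : ∑ a ∈ Finset.Ioo (-(5 ^ n) : ℤ) (5 ^ n),
      ∑ r ∈ T.filter (fun r => r.re = a), kerU M ((r.re : ℝ) / 5 ^ n) ≤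
      240 * 96 ^ n * (2 * Z) := by
    calc _ ≤ ∑ a ∈ Finset.Ioo (-(5 ^ n) : ℤ) (5 ^ n),
          240 * 96 ^ n * (((5 ^ n - |a| : ℤ) : ℝ) ^ (-(7 / 6) : ℝ)) := by
          refine Finset.sum_le_sum fun a ha => sum_kerU_fiber_le ?_ _ (hfib a)
          rw [abs_lt]; simpa using ha
      _ ≤ 240 * 96 ^ n * (∑ a ∈ Finset.Ioo (-(5 ^ n) : ℤ) (5 ^ n),
          ((((5 ^ n - a : ℤ) : ℝ) ^ (-(7 / 6) : ℝ)) + (((5 ^ n + a : ℤ) : ℝ) ^ (-(7 / 6) : ℝ)))) := by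
          rw [← Finset.mul_sum]
          gcongr with a ha
          simp at ha
          have e1 : (0 : ℝ) ≤ ((5 ^ n - a : ℤ) : ℝ) := Int.cast_nonneg (by omega)
          have e2 : (0 : ℝ) ≤ ((5 ^ n + a : ℤ) : ℝ) := Int.cast_nonneg (by omega)
          rcases abs_choice a with h | h <;> rw [h]
          · have := Real.rpow_nonneg e2 (-(7 / 6))
            linarith
          · have := Real.rpow_nonneg e1 (-(7 / 6))
            rw [sub_neg_eq_add]
            linarith
      _ ≤ 240 * 96 ^ n * (2 * Z) := by
          rw [Finset.sum_add_distrib, two_mul]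
          gcongr
          · exact sum_rpow_neg_le (fun a => 5 ^ n - a) (fun a _ b _ h => by simpa using h)
              fun a ha => by simp at ha; omega
          · exact sum_rpow_neg_le (fun a => 5 ^ n + a) (fun a _ b _ h => by simpa using h)
              fun a ha => by simp at ha; omega
  have : (0 : ℝ) < 96 ^ n := by positivity
  nlinarith

end

section
open Quaternion

/-- The self-correlation of the reduced words of length `n` measured by the kernel `U_M ^ 4`. -/
noncomputable def corrU (M n : ℕ) : ℝ :=
  ∑ w ∈ redWords n, ∑ w' ∈ redWords n,
    kerU M (((star (wordProd w) * wordProd w').re : ℝ) / 5 ^ n)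

lemma re_star_cons_mul_cons (a : Fin 6) (w w' : List (Fin 6)) :
    (star (wordProd (a :: w)) * wordProd (a :: w')).re =
      5 * (star (wordProd w) * wordProd w').re := by
  have h5 : star (wordProd w) * 5 = 5 * star (wordProd w) :=
    (Nat.cast_commute 5 (star (wordProd w))).eq.symm
  rw [wordProd_cons, wordProd_cons, star_mul, star_gen, mul_assoc, ← mul_assoc (gen (bar a)),
    gen_bar_mul_gen, ← mul_assoc, h5, mul_assoc, re_five_mul]

lemma sum_same_head_le (M n : ℕ) :
    ∑ w ∈ redWords (n + 1), ∑ w' ∈ redWords (n + 1), (if w.head? = w'.head? then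
      kerU M (((star (wordProd w) * wordProd w').re : ℝ) / 5 ^ (n + 1)) else 0) ≤
    6 * corrU M n := by
  rw [sum_redWords_succ]
  have h : ∀ a : Fin 6, ∑ l ∈ (redWords n).filter (fun l => l.head? ≠ some (bar a)),
      (∑ w' ∈ redWords (n + 1), (if (a :: l).head? = w'.head? then
      kerU M (((star (wordProd (a :: l)) * wordProd w').re : ℝ) / 5 ^ (n + 1)) else 0)) ≤
      corrU M n := by
    intro a
    rw [corrU]
    refine (Finset.sum_le_sum fun l _ => ?_).trans (Finset.sum_le_sum_of_subset_of_nonneg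
      (Finset.filter_subset _ _) fun _ _ _ => Finset.sum_nonneg fun _ _ => kerU_nonneg _ _)
    rw [sum_redWords_succ, Finset.sum_eq_single a]
    · refine (Finset.sum_le_sum fun l' _ => ?_).trans (Finset.sum_le_sum_of_subset_of_nonneg
        (Finset.filter_subset _ _) fun _ _ _ => kerU_nonneg _ _)
      rw [if_pos (by simp), re_star_cons_mul_cons]
      apply le_of_eq
      congr 1
      push_cast
      field_simp
      ring
    · intro b _ hba
      refine Finset.sum_eq_zero fun l' _ => if_neg ?_
      simpa using fun h => hba h.symm
    · simp
  calc _ ≤ ∑ a : Fin 6, corrU M n := Finset.sum_le_sum fun a _ => h a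
    _ = _ := by simp

lemma exists_sum_ne_head_le : ∃ C : ℝ, 0 < C ∧ ∀ M n : ℕ,
    ∑ w ∈ redWords (n + 1), ∑ w' ∈ redWords (n + 1), (if w.head? = w'.head? then 0 else
      kerU M (((star (wordProd w) * wordProd w').re : ℝ) / 5 ^ (n + 1))) ≤
    2 * ((M : ℝ) + 1) ^ 4 + C * 96 ^ (n + 1) := by
  classical
  obtain ⟨C, hC, h⟩ := exists_sum_kerU_le
  refine ⟨C, hC, fun M n => ?_⟩
  rw [← Finset.sum_product']
  have hite : ∀ p : List (Fin 6) × List (Fin 6), (if p.1.head? = p.2.head? then 0 else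
      kerU M (((star (wordProd p.1) * wordProd p.2).re : ℝ) / 5 ^ (n + 1))) =
      if ¬ p.1.head? = p.2.head? then
        kerU M (((star (wordProd p.1) * wordProd p.2).re : ℝ) / 5 ^ (n + 1)) else 0 := fun p => by
    rw [ite_not]
  simp only [hite]
  rw [← Finset.sum_filter]
  set P := {p ∈ redWords (n + 1) ×ˢ redWords (n + 1) | ¬ p.1.head? = p.2.head?} with hP
  have hword : ∀ p ∈ P, star (wordProd p.1) * wordProd p.2 =
      wordProd (p.1.reverse.map bar ++ p.2) ∧ Reduced (p.1.reverse.map bar ++ p.2) ∧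
      p.1.length = n + 1 ∧ p.2.length = n + 1 := by
    rintro ⟨l, l'⟩ hp
    rw [hP, Finset.mem_filter, Finset.mem_product, mem_redWords, mem_redWords] at hp
    obtain ⟨⟨⟨h1, h2⟩, h3, h4⟩, h5⟩ := hp
    refine ⟨by rw [star_wordProd, wordProd_append], ?_, h1, h3⟩
    cases l with
    | nil => simp at h1
    | cons a l =>
      cases l' with
      | nil => simp at h3
      | cons b l' => exact reduced_reverse_append h2 h4 (by simpa using h5)
  have hinj : Set.InjOn (fun p : List (Fin 6) × List (Fin 6) =>
      star (wordProd p.1) * wordProd p.2) P := by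
    intro p hp q hq hpq
    obtain ⟨p1, p2, p3, p4⟩ := hword p hp
    obtain ⟨q1, q2, q3, q4⟩ := hword q hq
    simp only [p1, q1] at hpq
    have := p2.eq_of_wordProd_eq q2 (by simp [p3, p4, q3, q4]) hpq
    obtain ⟨e1, e2⟩ := List.append_inj this (by simp [p3, q3])
    have hb : Function.Injective bar := Function.LeftInverse.injective bar_bar
    exact Prod.ext (List.reverse_injective (List.map_injective_iff.2 hb e1)) e2
  have := h (n + 1) M (P.image fun p => star (wordProd p.1) * wordProd p.2) ?_
  · rwa [Finset.sum_image hinj] at this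
  · intro r hr
    obtain ⟨p, hp, rfl⟩ := Finset.mem_image.1 hr
    obtain ⟨p1, p2, p3, p4⟩ := hword p hp
    simp only [p1]
    rw [normSq_wordProd, List.length_append, List.length_map, List.length_reverse, p3, p4,
      ← two_mul, pow_mul]
    norm_num

lemma exists_corrU_le : ∃ C : ℝ, 0 < C ∧ ∀ M n : ℕ,
    corrU M n ≤ 2 * 6 ^ n * ((M : ℝ) + 1) ^ 4 + C * 96 ^ n := by
  obtain ⟨C, hC, h⟩ := exists_sum_ne_head_le
  refine ⟨2 * C, by positivity, fun M n => ?_⟩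
  suffices h' : corrU M n ≤ (2 * 6 ^ n - 1) * ((M : ℝ) + 1) ^ 4 + 2 * C * 96 ^ n by
    have : (0 : ℝ) ≤ ((M : ℝ) + 1) ^ 4 := by positivity
    linarith
  induction n with
  | zero =>
    have : corrU M 0 ≤ ((M : ℝ) + 1) ^ 4 := by
      have : corrU M 0 = kerU M 1 := by simp [corrU, redWords]
      rw [this]
      exact kerU_le (by simp)
    norm_num
    linarith
  | succ n ih =>
    have h1 : corrU M (n + 1) ≤ 6 * corrU M n +
        (2 * ((M : ℝ) + 1) ^ 4 + C * 96 ^ (n + 1)) := by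
      refine le_trans (le_of_eq ?_) (add_le_add (sum_same_head_le M n) (h M n))
      rw [corrU, ← Finset.sum_add_distrib]
      refine Finset.sum_congr rfl fun w _ => ?_
      rw [← Finset.sum_add_distrib]
      refine Finset.sum_congr rfl fun w' _ => ?_
      split_ifs <;> simp
    have e1 : (0 : ℝ) ≤ ((M : ℝ) + 1) ^ 4 := by positivity
    have e2 : (0 : ℝ) < C * 96 ^ n := by positivity
    have e3 : (1 : ℝ) ≤ 6 ^ n := one_le_pow₀ (by norm_num)
    rw [pow_succ (96 : ℝ), pow_succ (6 : ℝ)] at *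
    nlinarith

end

section
open Matrix

/-- The weighted monomials of degree `m`. -/
noncomputable def monVec (m : ℕ) (x y : ℂ) : Fin (m + 1) → ℂ :=
  fun j => (√(m.choose j) : ℝ) * (x ^ (j : ℕ) * y ^ (m - j))

/-- The numerator polynomials of the symmetric power. -/
noncomputable def symPoly (m : ℕ) (A : Matrix (Fin 2) (Fin 2) ℂ) (j : ℕ) : Polynomial ℂ :=
  (Polynomial.C (A 0 0) * Polynomial.X + Polynomial.C (A 0 1)) ^ j *
    (Polynomial.C (A 1 0) * Polynomial.X + Polynomial.C (A 1 1)) ^ (m - j)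

/-- The `m`-th symmetric power of a `2 × 2` matrix, in the orthonormal basis of weighted
monomials. -/
noncomputable def symPow (m : ℕ) (A : Matrix (Fin 2) (Fin 2) ℂ) :
    Matrix (Fin (m + 1)) (Fin (m + 1)) ℂ :=
  of fun j i => ((√(m.choose j) : ℝ) : ℂ) / (√(m.choose i) : ℝ) * (symPoly m A j).coeff i

lemma sqrt_choose_ne_zero {m : ℕ} (i : Fin (m + 1)) : ((√(m.choose i) : ℝ) : ℂ) ≠ 0 := by
  have : 0 < m.choose i := Nat.choose_pos (Nat.lt_succ_iff.1 i.2)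
  have h : (0 : ℝ) < m.choose i := by exact_mod_cast this
  exact_mod_cast (Real.sqrt_pos.2 h).ne'

lemma natDegree_symPoly_le (m : ℕ) (A : Matrix (Fin 2) (Fin 2) ℂ) {j : ℕ} (hj : j ≤ m) :
    (symPoly m A j).natDegree ≤ m := by
  rw [symPoly]
  refine Polynomial.natDegree_mul_le.trans ?_
  have h1 : ∀ (a b : ℂ) (k : ℕ), ((Polynomial.C a * Polynomial.X + Polynomial.C b) ^ k).natDegree
      ≤ k := fun a b k => by
    refine Polynomial.natDegree_pow_le.trans ?_
    have := Polynomial.natDegree_linear_le (a := a) (b := b)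
    nlinarith
  have := h1 (A 0 0) (A 0 1) j
  have := h1 (A 1 0) (A 1 1) (m - j)
  omega

lemma coeff_symPoly (m : ℕ) (A : Matrix (Fin 2) (Fin 2) ℂ) {j : ℕ} (hj : j ≤ m) :
    (symPoly m A j).coeff m = A 0 0 ^ j * A 1 0 ^ (m - j) := by
  have h1 : ∀ (a b : ℂ), (Polynomial.C a * Polynomial.X + Polynomial.C b).natDegree ≤ 1 :=
    fun a b => Polynomial.natDegree_linear_le
  have h2 : ∀ (a b : ℂ) (k : ℕ),
      ((Polynomial.C a * Polynomial.X + Polynomial.C b) ^ k).natDegree ≤ k := fun a b k =>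
    (Polynomial.natDegree_pow_le.trans (Nat.mul_le_mul_left k (h1 a b))).trans (by simp)
  have h3 : ∀ (a b : ℂ) (k : ℕ),
      ((Polynomial.C a * Polynomial.X + Polynomial.C b) ^ k).coeff k = a ^ k := fun a b k => by
    have := Polynomial.coeff_pow_of_natDegree_le (m := k) (h1 a b)
    simpa using this
  have := Polynomial.coeff_mul_add_eq_of_natDegree_le (h2 (A 0 0) (A 0 1) j)
    (h2 (A 1 0) (A 1 1) (m - j))
  rw [Nat.add_sub_cancel' hj] at this
  rw [symPoly, this, h3, h3]

lemma symPow_mulVec_monVec (m : ℕ) (A : Matrix (Fin 2) (Fin 2) ℂ) (x y : ℂ) :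
    symPow m A *ᵥ monVec m x y = monVec m (A 0 0 * x + A 0 1 * y) (A 1 0 * x + A 1 1 * y) := by
  ext j
  have hj : (j : ℕ) ≤ m := Nat.lt_succ_iff.1 j.2
  have h1 : (symPow m A *ᵥ monVec m x y) j = (√(m.choose j) : ℝ) *
      ∑ i ∈ Finset.range (m + 1), (symPoly m A j).coeff i * (x ^ i * y ^ (m - i)) := by
    rw [mulVec, dotProduct, Finset.mul_sum, ← Fin.sum_univ_eq_sum_range (fun i =>
      ((√(m.choose j) : ℝ) : ℂ) * ((symPoly m A j).coeff i * (x ^ i * y ^ (m - i))))]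
    refine Finset.sum_congr rfl fun i _ => ?_
    have := sqrt_choose_ne_zero i
    rw [symPow, of_apply, monVec]
    field_simp
  rw [h1, monVec]
  congr 1
  by_cases hy : y = 0
  · subst hy
    rw [Finset.sum_eq_single m]
    · rw [coeff_symPoly m A hj]
      simp only [Nat.sub_self, pow_zero, mul_one, mul_zero, add_zero]
      rw [mul_pow, mul_pow]
      calc _ = A 0 0 ^ (j : ℕ) * A 1 0 ^ (m - j) * x ^ (j + (m - j) : ℕ) := by
            rw [Nat.add_sub_cancel' hj]
        _ = _ := by rw [pow_add]; ring
    · intro i hi hne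
      simp at hi
      rw [zero_pow (by omega)]
      simp
    · simp
  · have h2 : ∀ i ∈ Finset.range (m + 1), (symPoly m A j).coeff i * (x ^ i * y ^ (m - i)) =
        y ^ m * ((symPoly m A j).coeff i * (x / y) ^ i) := by
      intro i hi
      simp at hi
      have hm : y ^ m = y ^ i * y ^ (m - i) := by
        rw [← pow_add, Nat.add_sub_cancel' (by omega)]
      rw [div_pow, hm]
      field_simp
    rw [Finset.sum_congr rfl h2, ← Finset.mul_sum, ← Polynomial.eval_eq_sum_range' (Nat.lt_succ_of_le
      (natDegree_symPoly_le m A hj)), symPoly]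
    simp only [Polynomial.eval_mul, Polynomial.eval_pow, Polynomial.eval_add, Polynomial.eval_C,
      Polynomial.eval_X]
    calc _ = y ^ (j + (m - j) : ℕ) * ((A 0 0 * (x / y) + A 0 1) ^ (j : ℕ) *
          (A 1 0 * (x / y) + A 1 1) ^ (m - j : ℕ)) := by rw [Nat.add_sub_cancel' hj]
      _ = (y * (A 0 0 * (x / y) + A 0 1)) ^ (j : ℕ) *
          (y * (A 1 0 * (x / y) + A 1 1)) ^ (m - j : ℕ) := by
        rw [pow_add, mul_pow, mul_pow]; ring
      _ = _ := by
        congr 2 <;> field_simp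

lemma eq_zero_of_dotProduct_monVec {m : ℕ} {u : Fin (m + 1) → ℂ}
    (h : ∀ z, u ⬝ᵥ monVec m z 1 = 0) : u = 0 := by
  set p : Polynomial ℂ := ∑ i : Fin (m + 1),
    Polynomial.monomial (i : ℕ) (u i * ((√(m.choose i) : ℝ) : ℂ)) with hp
  have hp0 : p = 0 := by
    refine Polynomial.funext fun z => ?_
    rw [Polynomial.eval_zero, ← h z, hp, Polynomial.eval_finsetSum, dotProduct]
    refine Finset.sum_congr rfl fun i _ => ?_
    simp [monVec, mul_assoc]
  ext i
  have h1 := congrArg (fun q => Polynomial.coeff q i) hp0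
  simp only [hp, Polynomial.finsetSum_coeff, Polynomial.coeff_monomial, Polynomial.coeff_zero,
    Fin.val_inj, Finset.sum_ite_eq', Finset.mem_univ, if_true] at h1
  exact (mul_eq_zero.1 h1).resolve_right (sqrt_choose_ne_zero i)

lemma matrix_ext_monVec {m : ℕ} {A B : Matrix (Fin (m + 1)) (Fin (m + 1)) ℂ}
    (h : ∀ z, A *ᵥ monVec m z 1 = B *ᵥ monVec m z 1) : A = B := by
  ext j i
  have := eq_zero_of_dotProduct_monVec (u := A j - B j) fun z => by
    have := congrFun (h z) j
    rw [mulVec, mulVec] at this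
    rw [sub_dotProduct, this, sub_self]
  exact sub_eq_zero.1 (congrFun this i)

lemma symPow_mul (m : ℕ) (A B : Matrix (Fin 2) (Fin 2) ℂ) :
    symPow m (A * B) = symPow m A * symPow m B := by
  refine matrix_ext_monVec fun z => ?_
  rw [← mulVec_mulVec, symPow_mulVec_monVec, symPow_mulVec_monVec, symPow_mulVec_monVec]
  simp only [mul_apply, Fin.sum_univ_two]
  congr 1 <;> ring

lemma symPow_smul_one (m : ℕ) (c : ℂ) : symPow m (c • 1) = c ^ m • 1 := by
  refine matrix_ext_monVec fun z => ?_
  rw [symPow_mulVec_monVec, smul_mulVec, one_mulVec]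
  ext j
  have hj : (j : ℕ) ≤ m := Nat.lt_succ_iff.1 j.2
  have h1 : (1 : Matrix (Fin 2) (Fin 2) ℂ) 0 1 = 0 := one_apply_ne (by decide)
  have h2 : (1 : Matrix (Fin 2) (Fin 2) ℂ) 1 0 = 0 := one_apply_ne (by decide)
  simp only [monVec, Matrix.smul_apply, one_apply_eq, Pi.smul_apply, smul_eq_mul, mul_one, h1, h2]
  simp only [mul_zero, zero_mul, add_zero, zero_add, mul_pow, one_pow, mul_one]
  calc _ = c ^ (j + (m - j) : ℕ) * ((√(m.choose j) : ℝ) * z ^ (j : ℕ)) := by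
        rw [pow_add]; ring
    _ = _ := by rw [Nat.add_sub_cancel' hj]

lemma star_monVec_dotProduct (m : ℕ) (x y x' y' : ℂ) :
    star (monVec m x y) ⬝ᵥ monVec m x' y' = (star x * x' + star y * y') ^ m := by
  rw [add_pow, dotProduct, ← Fin.sum_univ_eq_sum_range (fun i =>
    (star x * x') ^ i * (star y * y') ^ (m - i) * (m.choose i : ℂ))]
  refine Finset.sum_congr rfl fun i _ => ?_
  have h : (((√(m.choose i) : ℝ) : ℂ)) * ((√(m.choose i) : ℝ) : ℂ) = (m.choose i : ℂ) := by
    rw [← Complex.ofReal_mul, Real.mul_self_sqrt (by positivity)]; simp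
  simp only [monVec, Pi.star_apply, star_mul', star_pow]
  have h' : star ((√(m.choose i) : ℝ) : ℂ) = ((√(m.choose i) : ℝ) : ℂ) := Complex.conj_ofReal _
  rw [h', ← h, mul_pow, mul_pow]; ring

lemma symPow_conjTranspose (m : ℕ) (A : Matrix (Fin 2) (Fin 2) ℂ) :
    symPow m Aᴴ = (symPow m A)ᴴ := by
  refine matrix_ext_monVec fun z => ?_
  rw [← sub_eq_zero, ← star_eq_zero]
  refine eq_zero_of_dotProduct_monVec fun w => ?_
  rw [← star_eq_zero, star_dotProduct, star_star, dotProduct_sub, sub_eq_zero,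
    symPow_mulVec_monVec, star_monVec_dotProduct, dotProduct_mulVec, ← star_mulVec,
    symPow_mulVec_monVec, star_monVec_dotProduct]
  simp only [conjTranspose_apply, star_add, star_mul', star_one]
  ring

lemma trace_symPow_diagonal (m : ℕ) (a b : ℂ) (A : Matrix (Fin 2) (Fin 2) ℂ) (h00 : A 0 0 = a)
    (h01 : A 0 1 = 0) (h10 : A 1 0 = 0) (h11 : A 1 1 = b) :
    (symPow m A).trace = ∑ j ∈ Finset.range (m + 1), a ^ j * b ^ (m - j) := by
  rw [trace, ← Fin.sum_univ_eq_sum_range (fun j => a ^ j * b ^ (m - j))]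
  refine Finset.sum_congr rfl fun j _ => ?_
  rw [diag_apply, symPow, of_apply, div_self (sqrt_choose_ne_zero j), one_mul, symPoly, h00, h01,
    h10, h11]
  simp only [Polynomial.C_0, add_zero, zero_mul, zero_add, mul_pow, ← Polynomial.C_pow]
  rw [mul_comm, ← mul_assoc, ← Polynomial.C_mul, Polynomial.coeff_C_mul, Polynomial.coeff_X_pow]
  simp [mul_comm]

lemma sum_pow_mul_pow_eq_U (m : ℕ) (a b : ℂ) (hab : a * b = 1) :
    ∑ j ∈ Finset.range (m + 1), a ^ j * b ^ (m - j) =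
      (Polynomial.Chebyshev.U ℂ m).eval ((a + b) / 2) := by
  have hs : ∀ n, ∑ j ∈ Finset.range (n + 1 + 1), a ^ j * b ^ (n + 1 - j) =
      b * ∑ j ∈ Finset.range (n + 1), a ^ j * b ^ (n - j) + a ^ (n + 1) := by
    intro n
    rw [Finset.sum_range_succ, Finset.mul_sum]
    congr 1
    · refine Finset.sum_congr rfl fun j hj => ?_
      simp at hj
      rw [show n + 1 - j = n - j + 1 by omega, pow_succ]; ring
    · simp
  induction m using Nat.twoStepInduction with
  | zero => simp
  | one => simp [Finset.sum_range_succ]; ring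
  | more m ih1 ih2 =>
    have h := Polynomial.Chebyshev.U_add_two ℂ (m : ℤ)
    push_cast at ih2 ⊢
    rw [h]
    simp only [Polynomial.eval_sub, Polynomial.eval_mul, Polynomial.eval_ofNat, Polynomial.eval_X]
    rw [← ih1, ← ih2, hs (m + 1)]
    have := hs m
    linear_combination -a * this - hab * ∑ j ∈ Finset.range (m + 1), a ^ j * b ^ (m - j)

end

section
open Matrix Quaternion

/-- The standard embedding of the quaternions into `2 × 2` complex matrices. -/
def toMat (q : ℍ[ℝ]) : Matrix (Fin 2) (Fin 2) ℂ :=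
  !![⟨q.re, q.imI⟩, ⟨q.imJ, q.imK⟩; ⟨-q.imJ, q.imK⟩, ⟨q.re, -q.imI⟩]

lemma toMat_mul (p q : ℍ[ℝ]) : toMat (p * q) = toMat p * toMat q := by
  ext i j
  fin_cases i <;> fin_cases j <;>
    simp [toMat, Matrix.mul_apply, Fin.sum_univ_two, Complex.ext_iff] <;>
    constructor <;> ring

lemma toMat_coe (t : ℝ) : toMat (t : ℍ[ℝ]) = (t : ℂ) • 1 := by
  ext i j
  fin_cases i <;> fin_cases j <;> simp [toMat, Complex.ext_iff]

lemma toMat_star (q : ℍ[ℝ]) : toMat (star q) = (toMat q)ᴴ := by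
  ext i j
  fin_cases i <;> fin_cases j <;> simp [toMat, Complex.ext_iff]

/-- The real quaternion with given coordinates. -/
def mkQ (a b c d : ℝ) : ℍ[ℝ] := ⟨a, b, c, d⟩

@[simp] lemma re_mkQ (a b c d : ℝ) : (mkQ a b c d).re = a := rfl
@[simp] lemma imI_mkQ (a b c d : ℝ) : (mkQ a b c d).imI = b := rfl
@[simp] lemma imJ_mkQ (a b c d : ℝ) : (mkQ a b c d).imJ = c := rfl
@[simp] lemma imK_mkQ (a b c d : ℝ) : (mkQ a b c d).imK = d := rfl

/-- The irreducible representation of the unit quaternions of dimension `m + 1`. -/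
noncomputable def rho (m : ℕ) (q : ℍ[ℝ]) : Matrix (Fin (m + 1)) (Fin (m + 1)) ℂ :=
  symPow m (toMat q)

lemma rho_mul (m : ℕ) (p q : ℍ[ℝ]) : rho m (p * q) = rho m p * rho m q := by
  rw [rho, toMat_mul, symPow_mul]; rfl

lemma rho_coe (m : ℕ) (t : ℝ) : rho m (t : ℍ[ℝ]) = ((t : ℂ) ^ m) • 1 := by
  rw [rho, toMat_coe, symPow_smul_one]

lemma rho_one (m : ℕ) : rho m 1 = 1 := by
  have := rho_coe m 1
  simpa using this

lemma rho_star (m : ℕ) (q : ℍ[ℝ]) : rho m (star q) = (rho m q)ᴴ := by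
  rw [rho, toMat_star, symPow_conjTranspose]; rfl

lemma trace_rho_of_diagonal {m : ℕ} {q : ℍ[ℝ]} (hq : normSq q = 1) (hJ : q.imJ = 0)
    (hK : q.imK = 0) : (rho m q).trace = ((Polynomial.Chebyshev.U ℝ m).eval q.re : ℝ) := by
  rw [normSq_def', hJ, hK] at hq
  rw [rho, trace_symPow_diagonal m ⟨q.re, q.imI⟩ ⟨q.re, -q.imI⟩ _ rfl
    (by simp [toMat, hJ, hK, Complex.ext_iff]) (by simp [toMat, hJ, hK, Complex.ext_iff]) rfl,
    sum_pow_mul_pow_eq_U, Polynomial.Chebyshev.complex_ofReal_eval_U]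
  · congr 1
    apply Complex.ext <;> simp
  · apply Complex.ext <;> simp
    · linarith
    · ring

lemma trace_rho {m : ℕ} {q : ℍ[ℝ]} (hq : normSq q = 1) :
    (rho m q).trace = ((Polynomial.Chebyshev.U ℝ m).eval q.re : ℝ) := by
  set t := √(q.imI ^ 2 + q.imJ ^ 2 + q.imK ^ 2) with ht
  have ht2 : t ^ 2 = q.imI ^ 2 + q.imJ ^ 2 + q.imK ^ 2 := Real.sq_sqrt (by positivity)
  set h : ℍ[ℝ] := mkQ (t + q.imI) 0 q.imK (-q.imJ) with hh
  set p : ℍ[ℝ] := mkQ q.re t 0 0 with hp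
  by_cases h0 : h = 0
  · have hJ : q.imJ = 0 := by have := congrArg QuaternionAlgebra.imK h0; simpa [hh] using this
    have hK : q.imK = 0 := by have := congrArg QuaternionAlgebra.imJ h0; simpa [hh] using this
    exact trace_rho_of_diagonal hq hJ hK
  · have hcomm : h * q = p * h := by
      apply QuaternionAlgebra.ext <;> simp [hh, hp] <;> nlinarith
    have hq' : q = h⁻¹ * (p * h) := by rw [← hcomm, ← mul_assoc, inv_mul_cancel₀ h0, one_mul]
    have hp1 : normSq p = 1 := by
      rw [normSq_def'] at hq ⊢
      simp only [hp, re_mkQ, imI_mkQ, imJ_mkQ, imK_mkQ]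
      rw [ht2]; linarith
    have : (rho m q).trace = (rho m p).trace := by
      rw [hq', rho_mul, trace_mul_comm, ← rho_mul, mul_assoc, mul_inv_cancel₀ h0, mul_one]
    rw [this, trace_rho_of_diagonal hp1 rfl rfl, hp, re_mkQ]

/-- Integer quaternions as real quaternions. -/
def castQ (r : ℍ[ℤ]) : ℍ[ℝ] := ⟨r.re, r.imI, r.imJ, r.imK⟩

@[simp] lemma re_castQ (r : ℍ[ℤ]) : (castQ r).re = r.re := rfl
@[simp] lemma imI_castQ (r : ℍ[ℤ]) : (castQ r).imI = r.imI := rfl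
@[simp] lemma imJ_castQ (r : ℍ[ℤ]) : (castQ r).imJ = r.imJ := rfl
@[simp] lemma imK_castQ (r : ℍ[ℤ]) : (castQ r).imK = r.imK := rfl

lemma castQ_mul (r s : ℍ[ℤ]) : castQ (r * s) = castQ r * castQ s := by
  apply QuaternionAlgebra.ext <;> simp

lemma castQ_star (r : ℍ[ℤ]) : castQ (star r) = star (castQ r) := by
  apply QuaternionAlgebra.ext <;> simp

/-- The generators, normalised to norm `1`. -/
noncomputable def unitGen (a : Fin 6) : ℍ[ℝ] := (√5)⁻¹ • castQ (gen a)

/-- The unit quaternion spelled by a word. -/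
noncomputable def unitWord (l : List (Fin 6)) : ℍ[ℝ] := (l.map unitGen).prod

@[simp] lemma unitWord_nil : unitWord [] = 1 := rfl

@[simp] lemma unitWord_cons (a : Fin 6) (l : List (Fin 6)) :
    unitWord (a :: l) = unitGen a * unitWord l := by simp [unitWord]

lemma unitWord_eq (l : List (Fin 6)) :
    unitWord l = (√5)⁻¹ ^ l.length • castQ (wordProd l) := by
  induction l with
  | nil =>
    have : castQ 1 = 1 := by apply QuaternionAlgebra.ext <;> simp
    simp [this]
  | cons a l ih =>
    rw [unitWord_cons, wordProd_cons, ih, unitGen, castQ_mul, smul_mul_smul_comm,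
      List.length_cons, pow_succ']

lemma sqrt_five_inv_sq : (√5)⁻¹ * (√5)⁻¹ = (5 : ℝ)⁻¹ := by
  rw [← mul_inv, Real.mul_self_sqrt (by norm_num)]

lemma unitGen_bar_mul (a : Fin 6) : unitGen (bar a) * unitGen a = 1 := by
  rw [unitGen, unitGen, smul_mul_smul_comm, sqrt_five_inv_sq, ← castQ_mul, gen_bar_mul_gen]
  have : castQ 5 = (5 : ℝ) • 1 := by
    apply QuaternionAlgebra.ext <;> simp <;> rfl
  rw [this, smul_smul]
  norm_num

lemma unitGen_mul_bar (a : Fin 6) : unitGen a * unitGen (bar a) = 1 := by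
  have := unitGen_bar_mul (bar a)
  rwa [bar_bar] at this

lemma star_unitGen (a : Fin 6) : star (unitGen a) = unitGen (bar a) := by
  rw [unitGen, unitGen, Quaternion.star_smul, ← castQ_star, star_gen]

lemma normSq_unitGen (a : Fin 6) : normSq (unitGen a) = 1 := by
  have := star_mul_self (unitGen a)
  rw [star_unitGen, unitGen_bar_mul] at this
  exact (Quaternion.coe_injective (by rw [coe_one, this])).symm

lemma normSq_unitWord (l : List (Fin 6)) : normSq (unitWord l) = 1 := by
  induction l with
  | nil => simp
  | cons a l ih => rw [unitWord_cons, map_mul, normSq_unitGen, ih, one_mul]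

lemma re_star_unitWord_mul {n : ℕ} {w w' : List (Fin 6)} (hw : w.length = n)
    (hw' : w'.length = n) : (star (unitWord w) * unitWord w').re =
      ((star (wordProd w) * wordProd w').re : ℝ) / 5 ^ n := by
  rw [unitWord_eq, unitWord_eq, Quaternion.star_smul, smul_mul_smul_comm, hw, hw', ← castQ_star, ← castQ_mul,
    re_smul]
  simp only [re_castQ, smul_eq_mul]
  rw [← mul_pow, sqrt_five_inv_sq, inv_pow, div_eq_inv_mul]

end

section
open Matrix Quaternion

/-- The sum of the six generators in the representation of dimension `m + 1`. -/
noncomputable def hecke (m : ℕ) : Matrix (Fin (m + 1)) (Fin (m + 1)) ℂ :=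
  ∑ a, rho m (unitGen a)

lemma isHermitian_hecke (m : ℕ) : (hecke m).IsHermitian := by
  rw [IsHermitian, hecke, conjTranspose_sum]
  simp only [← rho_star, star_unitGen]
  exact (Function.Involutive.bijective bar_bar).sum_comp (fun a => rho m (unitGen a))

/-- The sum over the reduced words of length `n`. -/
noncomputable def wordSum (m n : ℕ) : Matrix (Fin (m + 1)) (Fin (m + 1)) ℂ :=
  ∑ w ∈ redWords n, rho m (unitWord w)

/-- The sum over the reduced words of length `n` which can be preceded by the letter `a`. -/
noncomputable def wordSumAfter (m n : ℕ) (a : Fin 6) : Matrix (Fin (m + 1)) (Fin (m + 1)) ℂ :=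
  ∑ w ∈ (redWords n).filter (fun l => l.head? ≠ some (bar a)), rho m (unitWord w)

lemma wordSum_zero (m : ℕ) : wordSum m 0 = 1 := by
  simp [wordSum, redWords, rho_one]

lemma wordSum_succ (m n : ℕ) :
    wordSum m (n + 1) = ∑ a, rho m (unitGen a) * wordSumAfter m n a := by
  rw [wordSum, sum_redWords_succ]
  simp only [unitWord_cons, rho_mul, wordSumAfter, Finset.mul_sum]

lemma wordSum_one (m : ℕ) : wordSum m 1 = hecke m := by
  rw [wordSum_succ, hecke]
  simp [wordSumAfter, redWords, rho_one, Finset.filter_singleton]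

lemma wordSumAfter_succ (m n : ℕ) (a : Fin 6) : wordSumAfter m (n + 1) a =
    wordSum m (n + 1) - rho m (unitGen (bar a)) * wordSumAfter m n (bar a) := by
  have h : wordSumAfter m (n + 1) a =
      ∑ b, if b = bar a then 0 else rho m (unitGen b) * wordSumAfter m n b := by
    rw [wordSumAfter, Finset.sum_filter, sum_redWords_succ]
    refine Finset.sum_congr rfl fun b _ => ?_
    by_cases hb : b = bar a
    · simp [hb]
    · simp [hb, wordSumAfter, Finset.mul_sum, rho_mul]
  rw [h, wordSum_succ, eq_sub_iff_add_eq, ← Finset.sum_erase_add _ _ (Finset.mem_univ (bar a)),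
    ← Finset.sum_erase_add _ _ (Finset.mem_univ (bar a))]
  simp only [if_true, add_zero]
  congr 1
  refine Finset.sum_congr rfl fun b hb => ?_
  rw [if_neg (Finset.ne_of_mem_erase hb)]

lemma sum_bar {M : Type*} [AddCommMonoid M] (f : Fin 6 → M) : ∑ a, f (bar a) = ∑ a, f a :=
  (Function.Involutive.bijective bar_bar).sum_comp f

lemma wordSum_add_two (m n : ℕ) :
    wordSum m (n + 2) = hecke m * wordSum m (n + 1) - ∑ a, wordSumAfter m n a := by
  rw [wordSum_succ]
  simp only [wordSumAfter_succ, mul_sub, ← mul_assoc, ← rho_mul, unitGen_mul_bar, rho_one, one_mul]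
  rw [Finset.sum_sub_distrib, sum_bar (fun a => wordSumAfter m n a), hecke, Finset.sum_mul]

lemma sum_wordSumAfter_zero (m : ℕ) : ∑ a, wordSumAfter m 0 a = (6 : ℂ) • 1 := by
  simp [wordSumAfter, redWords, rho_one, Finset.filter_singleton, ← Nat.cast_smul_eq_nsmul ℂ]

lemma sum_wordSumAfter_succ (m n : ℕ) :
    ∑ a, wordSumAfter m (n + 1) a = (5 : ℂ) • wordSum m (n + 1) := by
  simp only [wordSumAfter_succ]
  rw [Finset.sum_sub_distrib, sum_bar (fun a => rho m (unitGen a) * wordSumAfter m n a),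
    ← wordSum_succ, Finset.sum_const, Finset.card_univ, Fintype.card_fin,
    ← Nat.cast_smul_eq_nsmul ℂ, sub_eq_iff_eq_add]
  push_cast
  module

/-- The polynomials expressing the sum over reduced words in terms of the Hecke operator. -/
noncomputable def heckePoly (h : ℝ) : ℕ → ℝ
  | 0 => 1
  | 1 => h
  | 2 => h * h - 6
  | n + 3 => h * heckePoly h (n + 2) - 5 * heckePoly h (n + 1)

lemma wordSum_mulVec {m : ℕ} {h s : ℝ} (hs : s * s = 1) {v : Fin (m + 1) → ℂ}
    (hv : hecke m *ᵥ v = ((s * h : ℝ) : ℂ) • v) (n : ℕ) :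
    wordSum m n *ᵥ v = ((s ^ n * heckePoly h n : ℝ) : ℂ) • v := by
  have key : ∀ n, wordSum m n *ᵥ v = ((s ^ n * heckePoly h n : ℝ) : ℂ) • v ∧
      wordSum m (n + 1) *ᵥ v = ((s ^ (n + 1) * heckePoly h (n + 1) : ℝ) : ℂ) • v := by
    intro n
    induction n with
    | zero => simp [wordSum_zero, wordSum_one, heckePoly, hv]
    | succ n ih =>
      refine ⟨ih.2, ?_⟩
      rw [wordSum_add_two, sub_mulVec, ← mulVec_mulVec, ih.2, mulVec_smul, hv]
      cases n with
      | zero =>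
        rw [sum_wordSumAfter_zero, smul_mulVec, one_mulVec, smul_smul, ← sub_smul]
        congr 1
        simp only [heckePoly]
        norm_cast
        linear_combination (h * h - (h * h - 6)) * hs
      | succ n =>
        rw [sum_wordSumAfter_succ, smul_mulVec, ih.1, smul_smul, smul_smul, ← sub_smul]
        congr 1
        simp only [heckePoly]
        norm_cast
        linear_combination (5 * s ^ (n + 1) * heckePoly h (n + 1)) * hs
  exact (key n).1

lemma pow_le_heckePoly {b h : ℝ} (hb1 : 0 < b) (hb2 : b ≤ 5) (hb : b + 5 / b ≤ h) (n : ℕ) :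
    b ^ n ≤ heckePoly h n := by
  have h5 : 0 < 5 / b := by positivity
  have hb3 : b * (5 / b) = 5 := by field_simp
  have hb4 : 1 ≤ 5 / b := by rwa [le_div_iff₀ hb1, one_mul]
  have key : ∀ n, b ^ n ≤ heckePoly h n ∧ b * heckePoly h n ≤ heckePoly h (n + 1) := by
    intro n
    induction n with
    | zero => simp [heckePoly]; linarith
    | succ n ih =>
      have h1 : b ^ (n + 1) ≤ heckePoly h (n + 1) := by
        rw [pow_succ']
        exact (mul_le_mul_of_nonneg_left ih.1 hb1.le).trans ih.2
      refine ⟨h1, ?_⟩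
      have h2 : 0 < heckePoly h (n + 1) := lt_of_lt_of_le (by positivity) h1
      cases n with
      | zero =>
        simp only [heckePoly]
        nlinarith
      | succ n =>
        simp only [heckePoly]
        have h3 : 5 * heckePoly h (n + 1) ≤ (5 / b) * heckePoly h (n + 2) := by
          calc 5 * heckePoly h (n + 1) = (5 / b) * (b * heckePoly h (n + 1)) := by
                field_simp
            _ ≤ _ := mul_le_mul_of_nonneg_left ih.2 h5.le
        have h4 := mul_le_mul_of_nonneg_right hb h2.le
        nlinarith
  exact (key n).1

lemma trace_wordSum (m n : ℕ) : ((wordSum m n)ᴴ * wordSum m n).trace =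
    ((∑ w ∈ redWords n, ∑ w' ∈ redWords n, (Polynomial.Chebyshev.U ℝ m).eval
      (((star (wordProd w) * wordProd w').re : ℝ) / 5 ^ n) : ℝ) : ℂ) := by
  rw [wordSum, conjTranspose_sum, Finset.sum_mul_sum, trace_sum, Complex.ofReal_sum]
  refine Finset.sum_congr rfl fun w hw => ?_
  rw [trace_sum, Complex.ofReal_sum]
  refine Finset.sum_congr rfl fun w' hw' => ?_
  rw [← rho_star, ← rho_mul, trace_rho, re_star_unitWord_mul (mem_redWords.1 hw).1
    (mem_redWords.1 hw').1]
  rw [map_mul, normSq_star, normSq_unitWord, normSq_unitWord, one_mul]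

lemma trace_conjTranspose_mul_self {k : ℕ} (S : Matrix (Fin k) (Fin k) ℂ) :
    (Sᴴ * S).trace = ((∑ i, ∑ j, ‖S j i‖ ^ 2 : ℝ) : ℂ) := by
  rw [trace]
  push_cast
  refine Finset.sum_congr rfl fun i _ => ?_
  rw [diag_apply, mul_apply]
  refine Finset.sum_congr rfl fun j _ => ?_
  rw [conjTranspose_apply, ← Complex.conj_mul']
  rfl

lemma norm_sq_le_of_mulVec_eq {k : ℕ} {S : Matrix (Fin k) (Fin k) ℂ} {p : ℂ} {v : Fin k → ℂ}
    (hv : v ≠ 0) (h : S *ᵥ v = p • v) : ‖p‖ ^ 2 ≤ ∑ i, ∑ j, ‖S j i‖ ^ 2 := by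
  have hpos : 0 < ∑ i, ‖v i‖ ^ 2 := by
    obtain ⟨i, hi⟩ := Function.ne_iff.1 hv
    refine Finset.sum_pos' (fun _ _ => by positivity) ⟨i, Finset.mem_univ _, ?_⟩
    have : 0 < ‖v i‖ := norm_pos_iff.2 hi
    positivity
  refine le_of_mul_le_mul_right ?_ hpos
  rw [Finset.mul_sum, Finset.sum_comm, Finset.sum_mul]
  refine Finset.sum_le_sum fun j _ => ?_
  have h1 := congrFun h j
  rw [Pi.smul_apply, smul_eq_mul] at h1
  rw [← mul_pow, ← norm_mul, ← h1, mulVec, dotProduct]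
  calc ‖∑ i, S j i * v i‖ ^ 2 ≤ (∑ i, ‖S j i‖ * ‖v i‖) ^ 2 := by
        gcongr
        refine (norm_sum_le _ _).trans (le_of_eq ?_)
        simp
    _ ≤ _ := Finset.sum_mul_sq_le_sq_mul_sq _ _ _

/-- An eigenvalue in the representation of dimension `2 M + 1` is controlled by the
self-correlation of reduced words. -/
lemma eigenvalue_pow_le {M n : ℕ} {p : ℂ} {v : Fin (2 * M + 1) → ℂ} (hv : v ≠ 0)
    (h : wordSum (2 * M) n *ᵥ v = p • v) : (coeffU M M : ℝ) * ‖p‖ ^ 2 ≤ corrU M n := by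
  set t : ℕ → ℝ := fun m => ∑ w ∈ redWords n, ∑ w' ∈ redWords n,
    (Polynomial.Chebyshev.U ℝ (2 * m : ℕ)).eval
      (((star (wordProd w) * wordProd w').re : ℝ) / 5 ^ n) with ht
  have ht' : ∀ m, t m = ∑ i, ∑ j, ‖wordSum (2 * m) n j i‖ ^ 2 := by
    intro m
    have := (trace_wordSum (2 * m) n).symm.trans (trace_conjTranspose_mul_self _)
    exact Complex.ofReal_injective this
  have hcorr : corrU M n = ∑ m ∈ Finset.range (2 * M + 1), (coeffU M m : ℝ) * t m := by
    simp only [corrU, kerU_eq_sum, ht, Finset.mul_sum]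
    symm
    rw [Finset.sum_comm]
    exact Finset.sum_congr rfl fun w _ => Finset.sum_comm
  have h1 := norm_sq_le_of_mulVec_eq hv h
  rw [← ht'] at h1
  rw [hcorr]
  calc (coeffU M M : ℝ) * ‖p‖ ^ 2 ≤ coeffU M M * t M := by gcongr
    _ ≤ _ := by
      refine Finset.single_le_sum (f := fun m => (coeffU M m : ℝ) * t m) (fun m _ => ?_)
        (by simp; omega)
      rw [ht']
      positivity

end

section
open Matrix Quaternion
open scoped Matrix.Norms.L2Operator ComplexOrder

lemma exists_eigenvector_norm (m : ℕ) : ∃ (s : ℝ) (v : Fin (m + 1) → ℂ), s * s = 1 ∧ v ≠ 0 ∧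
    hecke m *ᵥ v = ((s * ‖hecke m‖ : ℝ) : ℂ) • v := by
  have key : ∀ t : ℝ, t ∈ spectrum ℝ (hecke m) → ∃ v : Fin (m + 1) → ℂ, v ≠ 0 ∧
      hecke m *ᵥ v = (t : ℂ) • v := by
    intro t ht
    rw [spectrum.mem_iff, isUnit_iff_isUnit_det, isUnit_iff_ne_zero, not_not,
      ← exists_mulVec_eq_zero_iff] at ht
    obtain ⟨v, hv, h⟩ := ht
    refine ⟨v, hv, ?_⟩
    rw [sub_mulVec, sub_eq_zero] at h
    rw [← h, Algebra.algebraMap_eq_smul_one, smul_mulVec, one_mulVec]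
    rfl
  rcases CStarAlgebra.norm_or_neg_norm_mem_spectrum (a := hecke m) (isHermitian_hecke m) with h | h
  · obtain ⟨v, hv, h⟩ := key _ h
    exact ⟨1, v, by norm_num, hv, by rw [h, one_mul]⟩
  · obtain ⟨v, hv, h⟩ := key _ h
    exact ⟨-1, v, by norm_num, hv, by rw [h, neg_one_mul]⟩

lemma rho_mem_unitary (m : ℕ) {q : ℍ[ℝ]} (hq : normSq q = 1) :
    rho m q ∈ unitary (Matrix (Fin (m + 1)) (Fin (m + 1)) ℂ) := by
  rw [Unitary.mem_iff]
  change (rho m q)ᴴ * rho m q = 1 ∧ rho m q * (rho m q)ᴴ = 1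
  rw [← rho_star, ← rho_mul, ← rho_mul, star_mul_self, self_mul_star, hq]
  simp [rho_one]

lemma norm_rho (m : ℕ) {q : ℍ[ℝ]} (hq : normSq q = 1) : ‖rho m q‖ = 1 :=
  CStarRing.norm_of_mem_unitary (rho_mem_unitary m hq)

lemma norm_hecke_le (m : ℕ) : ‖hecke m‖ ≤ 6 := by
  rw [hecke]
  refine (norm_sum_le _ _).trans ?_
  simp [norm_rho, normSq_unitGen]

lemma one_add_two_I_pow (k : ℕ) : ∃ x y : ℤ, (1 + 2 * Complex.I) ^ (k + 1) = x + y * Complex.I ∧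
    ¬ (5 : ℤ) ∣ x ∧ (5 : ℤ) ∣ y - 2 * x := by
  induction k with
  | zero => exact ⟨1, 2, by simp, by norm_num, by norm_num⟩
  | succ k ih =>
    obtain ⟨x, y, h, h1, h2⟩ := ih
    refine ⟨x - 2 * y, 2 * x + y, ?_, by omega, by omega⟩
    rw [pow_succ, h]
    push_cast
    linear_combination (2 * y) * Complex.I_sq

lemma one_add_two_I_div_pow_ne_one {k : ℕ} (hk : k ≠ 0) :
    ((1 + 2 * Complex.I) / ((√5 : ℝ) : ℂ)) ^ k ≠ 1 := by
  obtain ⟨k, rfl⟩ := Nat.exists_eq_succ_of_ne_zero hk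
  intro h
  obtain ⟨x, y, hxy, h1, h2⟩ := one_add_two_I_pow k
  have h5 : ((√5 : ℝ) : ℂ) ≠ 0 := by
    exact_mod_cast (Real.sqrt_pos.2 (by norm_num : (0 : ℝ) < 5)).ne'
  rw [div_pow, div_eq_one_iff_eq (pow_ne_zero _ h5), hxy] at h
  have := congrArg Complex.im h
  rw [← Complex.ofReal_pow, Complex.ofReal_im] at this
  simp at this
  subst this
  omega

lemma rho_mulVec_eq_of_norm_eq {m : ℕ} {s : ℝ} (hs : s * s = 1) {v : Fin (m + 1) → ℂ}
    (hv : hecke m *ᵥ v = ((s * 6 : ℝ) : ℂ) • v) (a : Fin 6) :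
    rho m (unitGen a) *ᵥ v = (s : ℂ) • v := by
  have hs' : (s : ℂ) * s = 1 := by exact_mod_cast hs
  have h0 : ∑ a, star (rho m (unitGen a) *ᵥ v - (s : ℂ) • v) ⬝ᵥ
      (rho m (unitGen a) *ᵥ v - (s : ℂ) • v) = 0 := by
    have h1 : ∀ a, star (rho m (unitGen a) *ᵥ v - (s : ℂ) • v) ⬝ᵥ
        (rho m (unitGen a) *ᵥ v - (s : ℂ) • v) = 2 * (star v ⬝ᵥ v) -
        s * (star (rho m (unitGen a) *ᵥ v) ⬝ᵥ v) - s * (star v ⬝ᵥ (rho m (unitGen a) *ᵥ v)) := by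
      intro a
      have h2 : star (rho m (unitGen a) *ᵥ v) ⬝ᵥ (rho m (unitGen a) *ᵥ v) = star v ⬝ᵥ v := by
        rw [star_mulVec, ← dotProduct_mulVec, mulVec_mulVec, ← rho_star, ← rho_mul,
          star_mul_self, normSq_unitGen]
        simp [rho_one]
      have h3 : star ((s : ℂ) • v) = (s : ℂ) • star v := by
        rw [StarModule.star_smul]; congr 1; exact Complex.conj_ofReal s
      rw [star_sub, sub_dotProduct, dotProduct_sub, dotProduct_sub, h2, h3]
      simp only [dotProduct_smul, smul_dotProduct, smul_eq_mul]
      linear_combination (star v ⬝ᵥ v) * hs'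
    simp only [h1]
    have hA : ∑ a, (s : ℂ) * (star (rho m (unitGen a) *ᵥ v) ⬝ᵥ v) =
        s * (star (hecke m *ᵥ v) ⬝ᵥ v) := by
      rw [← Finset.mul_sum, ← sum_dotProduct, ← star_sum, ← sum_mulVec, ← hecke]
    have hB : ∑ a, (s : ℂ) * (star v ⬝ᵥ (rho m (unitGen a) *ᵥ v)) =
        s * (star v ⬝ᵥ (hecke m *ᵥ v)) := by
      rw [← Finset.mul_sum, ← dotProduct_sum, ← sum_mulVec, ← hecke]
    have h3 : star (((s * 6 : ℝ) : ℂ) • v) = ((s * 6 : ℝ) : ℂ) • star v := by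
      rw [StarModule.star_smul]; congr 1; exact Complex.conj_ofReal _
    rw [Finset.sum_sub_distrib, Finset.sum_sub_distrib, hA, hB, hv, h3]
    simp only [dotProduct_smul, smul_dotProduct, smul_eq_mul, Finset.sum_const, Finset.card_univ,
      Fintype.card_fin, nsmul_eq_mul]
    push_cast
    linear_combination (-12 * (star v ⬝ᵥ v)) * hs'
  rw [Finset.sum_eq_zero_iff_of_nonneg fun a _ => dotProduct_star_self_nonneg _] at h0
  have := dotProduct_star_self_eq_zero.1 (h0 a (Finset.mem_univ a))
  exact sub_eq_zero.1 this

lemma unitGen_zero : unitGen 0 = mkQ (√5)⁻¹ (2 * (√5)⁻¹) 0 0 := by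
  apply QuaternionAlgebra.ext <;> rw [unitGen]
  · change (√5)⁻¹ * (((1 : ℤ)) : ℝ) = _; simp
  · change (√5)⁻¹ * (((2 : ℤ)) : ℝ) = _; simp [mul_comm]
  · change (√5)⁻¹ * (((0 : ℤ)) : ℝ) = _; simp
  · change (√5)⁻¹ * (((0 : ℤ)) : ℝ) = _; simp

lemma unitGen_two : unitGen 2 = mkQ (√5)⁻¹ 0 (2 * (√5)⁻¹) 0 := by
  apply QuaternionAlgebra.ext <;> rw [unitGen]
  · change (√5)⁻¹ * (((1 : ℤ)) : ℝ) = _; simp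
  · change (√5)⁻¹ * (((0 : ℤ)) : ℝ) = _; simp
  · change (√5)⁻¹ * (((2 : ℤ)) : ℝ) = _; simp [mul_comm]
  · change (√5)⁻¹ * (((0 : ℤ)) : ℝ) = _; simp

lemma norm_hecke_lt {M : ℕ} (hM : 1 ≤ M) : ‖hecke (2 * M)‖ < 6 := by
  refine lt_of_le_of_ne (norm_hecke_le _) fun heq => ?_
  obtain ⟨s, v, hs, hv, h⟩ := exists_eigenvector_norm (2 * M)
  rw [heq] at h
  have hs' : (s : ℂ) * s = 1 := by exact_mod_cast hs
  have hrho := rho_mulVec_eq_of_norm_eq hs h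
  have hinv : ∀ a x y, star v ⬝ᵥ (rho (2 * M) (unitGen a) *ᵥ monVec (2 * M) x y) =
      s * (star v ⬝ᵥ monVec (2 * M) x y) := by
    intro a x y
    have h1 := congrArg star (hrho (bar a))
    rw [star_mulVec, ← rho_star, star_unitGen, bar_bar, StarModule.star_smul] at h1
    rw [dotProduct_mulVec, h1, smul_dotProduct, smul_eq_mul]
    congr 1
    exact Complex.conj_ofReal s
  set α : ℂ := (1 + 2 * Complex.I) / ((√5 : ℝ) : ℂ) with hα
  set β : ℂ := (1 - 2 * Complex.I) / ((√5 : ℝ) : ℂ) with hβ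
  have h55 : ((√5 : ℝ) : ℂ) * ((√5 : ℝ) : ℂ) = 5 := by
    rw [← Complex.ofReal_mul, Real.mul_self_sqrt (by norm_num)]; norm_num
  have h5 : ((√5 : ℝ) : ℂ) ≠ 0 := fun h => by rw [h] at h55; norm_num at h55
  have hαβ : α * β = 1 := by
    rw [hα, hβ, div_mul_div_comm, h55]
    field_simp
    linear_combination (-4) * Complex.I_sq
  have hdiag : ∀ x y, rho (2 * M) (unitGen 0) *ᵥ monVec (2 * M) x y =
      monVec (2 * M) (α * x) (β * y) := by
    intro x y
    rw [rho, symPow_mulVec_monVec]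
    congr 1
    · rw [hα, div_eq_mul_inv, ← Complex.ofReal_inv]
      rw [unitGen_zero]
      generalize (√5)⁻¹ = t
      simp [toMat, Complex.ext_iff]
    · rw [hβ, div_eq_mul_inv, ← Complex.ofReal_inv]
      rw [unitGen_zero]
      generalize (√5)⁻¹ = t
      simp [toMat, Complex.ext_iff]
  have hsupp : ∀ j : Fin (2 * M + 1), (j : ℕ) ≠ M → star v j = 0 := by
    intro j hj
    have hz := eq_zero_of_dotProduct_monVec (m := 2 * M)
      (u := fun j => (α ^ (j : ℕ) * β ^ (2 * M - j) - s) * star v j) fun z => by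
        have := hinv 0 z 1
        rw [hdiag, ← sub_eq_zero] at this
        rw [← this]
        simp only [dotProduct, Finset.mul_sum, ← Finset.sum_sub_distrib]
        refine Finset.sum_congr rfl fun i _ => ?_
        simp only [monVec, mul_pow, mul_one, one_pow]
        ring
    have hz := congrFun hz j
    refine (mul_eq_zero.1 hz).resolve_left fun h0 => ?_
    rw [sub_eq_zero] at h0
    have hjM : (j : ℕ) ≤ 2 * M := Nat.lt_succ_iff.1 j.2
    have h1 : α ^ (2 * j : ℕ) = α ^ (2 * (2 * M - j) : ℕ) := by
      calc α ^ (2 * j : ℕ) = (α ^ (j : ℕ)) ^ 2 * (α * β) ^ (2 * (2 * M - j) : ℕ) := by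
            rw [hαβ, one_pow, mul_one, ← pow_mul, mul_comm]
        _ = (α ^ (j : ℕ) * β ^ (2 * M - j)) ^ 2 * α ^ (2 * (2 * M - j) : ℕ) := by
            rw [mul_pow α β, pow_mul' β]; ring
        _ = _ := by rw [h0, sq, hs', one_mul]
    have hα0 : α ≠ 0 := fun h => by rw [h] at hαβ; simp at hαβ
    have h2 : ∀ a b : ℕ, a < b → α ^ a = α ^ b → False := by
      intro a b hab h
      obtain ⟨k, rfl⟩ := Nat.exists_eq_add_of_lt hab
      refine one_add_two_I_div_pow_ne_one (k := k + 1) (by omega) ?_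
      rw [add_assoc, pow_add] at h
      exact (mul_eq_left₀ (pow_ne_zero a hα0)).1 h.symm
    rcases lt_trichotomy (2 * j : ℕ) (2 * (2 * M - j)) with hlt | heq | hlt
    · exact h2 _ _ hlt h1
    · omega
    · exact h2 _ _ hlt h1.symm
  apply hv
  rw [← star_eq_zero]
  have hdot : ∀ x y, star v ⬝ᵥ monVec (2 * M) x y =
      star v ⟨M, by omega⟩ * monVec (2 * M) x y ⟨M, by omega⟩ := by
    intro x y
    rw [dotProduct]
    refine Finset.sum_eq_single _ (fun j _ hj => ?_) (by simp)
    rw [hsupp j (fun h => hj (Fin.ext h)), zero_mul]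
  have hlast := hinv 2 1 0
  rw [rho, symPow_mulVec_monVec, hdot, hdot] at hlast
  have hM0 : 2 * M - M ≠ 0 := by omega
  simp only [monVec, mul_one, mul_zero, add_zero, zero_pow hM0] at hlast
  rw [mul_eq_zero] at hlast
  ext j
  by_cases hj : (j : ℕ) = M
  · have : j = ⟨M, by omega⟩ := Fin.ext hj
    rw [this]
    refine hlast.resolve_right ?_
    refine mul_ne_zero (sqrt_choose_ne_zero ⟨M, by omega⟩) (mul_ne_zero (pow_ne_zero _ ?_)
      (pow_ne_zero _ ?_))
    · simp [toMat, unitGen_two, Complex.ext_iff]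
    · simp [toMat, unitGen_two, Complex.ext_iff]
  · exact hsupp j hj

lemma exists_gap_of_large : ∃ N : ℕ, ∀ M, 2 ^ N ≤ M → ‖hecke (2 * M)‖ ≤ √24.5 + 5 / √24.5 := by
  obtain ⟨C, hC, hcorr⟩ := exists_corrU_le
  obtain ⟨N, hN⟩ := pow_unbounded_of_one_lt (256 + 2 * C) (show (1 : ℝ) < 24.5 / 24 by norm_num)
  refine ⟨N, fun M hM => ?_⟩
  by_contra! hlt
  have hb0 : 0 < √24.5 := Real.sqrt_pos.2 (by norm_num)
  have hb5 : √24.5 ≤ 5 := Real.sqrt_le_iff.2 ⟨by norm_num, by norm_num⟩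
  have hM0 : M ≠ 0 := by have := Nat.one_le_two_pow (n := N); omega
  obtain ⟨s, v, hs, hv, h⟩ := exists_eigenvector_norm (2 * M)
  set n := Nat.log 2 M with hn
  have hn1 : 2 ^ n ≤ M := Nat.pow_log_le_self 2 hM0
  have hn2 : M < 2 ^ (n + 1) := Nat.lt_pow_succ_log_self (by norm_num) M
  have hNn : N ≤ n := Nat.le_log_of_pow_le (by norm_num) hM
  have h1 := eigenvalue_pow_le hv (wordSum_mulVec hs h n)
  have h2 := pow_le_heckePoly hb0 hb5 hlt.le n
  have h3 := sq_le_two_mul_coeffU M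
  have h3' : (M : ℝ) ^ 2 ≤ 2 * coeffU M M := by exact_mod_cast h3
  have hsq : s ^ 2 = 1 := by rw [sq]; exact hs
  have h4 : (24.5 : ℝ) ^ n ≤ ‖((s ^ n * heckePoly ‖hecke (2 * M)‖ n : ℝ) : ℂ)‖ ^ 2 := by
    rw [Complex.norm_real, Real.norm_eq_abs, sq_abs, mul_pow, ← pow_mul, mul_comm n, pow_mul, hsq,
      one_pow, one_mul]
    calc (24.5 : ℝ) ^ n = (√24.5 ^ n) ^ 2 := by
          rw [← pow_mul, mul_comm, pow_mul, Real.sq_sqrt (by norm_num)]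
      _ ≤ _ := by gcongr
  have h5 := hcorr M n
  have hMr1 : (2 : ℝ) ^ n ≤ M := by exact_mod_cast hn1
  have hMr2 : (M : ℝ) + 1 ≤ 2 * 2 ^ n := by
    have : M + 1 ≤ 2 ^ (n + 1) := hn2
    rw [pow_succ'] at this
    exact_mod_cast this
  have e4 : (2 : ℝ) ^ n * 2 ^ n = 4 ^ n := by rw [← mul_pow]; norm_num
  have e6 : (6 : ℝ) ^ n * (2 ^ n) ^ 4 = 96 ^ n := by rw [← pow_mul, mul_comm n, pow_mul, ← mul_pow]; norm_num
  have e24 : (24 : ℝ) ^ n * 4 ^ n = 96 ^ n := by rw [← mul_pow]; norm_num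
  have h6 : (4 : ℝ) ^ n * 24.5 ^ n ≤ 2 * (32 * 96 ^ n + C * 96 ^ n) := by
    calc (4 : ℝ) ^ n * 24.5 ^ n ≤ (M : ℝ) ^ 2 * 24.5 ^ n := by
          gcongr
          rw [← e4, ← sq]; gcongr
      _ ≤ (2 * coeffU M M) * 24.5 ^ n := by gcongr
      _ = 2 * (coeffU M M * 24.5 ^ n) := by ring
      _ ≤ 2 * (coeffU M M * ‖((s ^ n * heckePoly ‖hecke (2 * M)‖ n : ℝ) : ℂ)‖ ^ 2) := by gcongr
      _ ≤ 2 * (2 * 6 ^ n * (M + 1) ^ 4 + C * 96 ^ n) := by linarith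
      _ ≤ 2 * (2 * 6 ^ n * (2 * 2 ^ n) ^ 4 + C * 96 ^ n) := by gcongr
      _ = _ := by rw [← e6]; ring
  have h7 : (24.5 / 24 : ℝ) ^ n ≤ 64 + 2 * C := by
    have p24 : (0 : ℝ) < 96 ^ n := by positivity
    refine le_of_mul_le_mul_right ?_ p24
    calc (24.5 / 24 : ℝ) ^ n * 96 ^ n = 4 ^ n * 24.5 ^ n := by
          rw [← mul_pow, ← mul_pow]; norm_num
      _ ≤ _ := h6
      _ = _ := by ring
  have h8 : (24.5 / 24 : ℝ) ^ N ≤ (24.5 / 24 : ℝ) ^ n := pow_le_pow_right₀ (by norm_num) hNn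
  linarith

/-- The spectral gap of the six rotations. -/
lemma exists_gap : ∃ γ : ℝ, 0 < γ ∧ γ < 1 ∧ ∀ M, 1 ≤ M → ‖hecke (2 * M)‖ ≤ 6 * γ := by
  obtain ⟨N, hN⟩ := exists_gap_of_large
  have hb0 : 0 < √24.5 := Real.sqrt_pos.2 (by norm_num)
  have hbsq : √24.5 * √24.5 = 24.5 := Real.mul_self_sqrt (by norm_num)
  have hb : √24.5 + 5 / √24.5 < 6 := by
    rw [← sub_pos]
    have : 6 - (√24.5 + 5 / √24.5) = (6 * √24.5 - 29.5) / √24.5 := by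
      field_simp; linarith
    rw [this]
    refine div_pos ?_ hb0
    nlinarith
  have key : ∀ K : ℕ, ∃ t : ℝ, 0 < t ∧ t < 6 ∧ ∀ M, 1 ≤ M → M < K → ‖hecke (2 * M)‖ ≤ t := by
    intro K
    induction K with
    | zero => exact ⟨1, by norm_num, by norm_num, fun M _ h => absurd h (by omega)⟩
    | succ K ih =>
      obtain ⟨t, h0, h6, h⟩ := ih
      rcases Nat.eq_zero_or_pos K with rfl | hK
      · exact ⟨t, h0, h6, fun M h1 h2 => by omega⟩
      · refine ⟨max t ‖hecke (2 * K)‖, lt_max_of_lt_left h0, max_lt h6 (norm_hecke_lt hK),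
          fun M h1 h2 => ?_⟩
        rcases Nat.lt_succ_iff_lt_or_eq.1 h2 with h3 | rfl
        · exact (h M h1 h3).trans (le_max_left _ _)
        · exact le_max_right _ _
  obtain ⟨t, h0, h6, h⟩ := key (2 ^ N)
  refine ⟨max t (√24.5 + 5 / √24.5) / 6, by positivity, ?_, fun M hM => ?_⟩
  · rw [div_lt_one (by norm_num)]; exact max_lt h6 hb
  · rw [mul_div_cancel₀ _ (by norm_num)]
    rcases lt_or_ge M (2 ^ N) with h1 | h1
    · exact (h M hM h1).trans (le_max_left _ _)
    · exact (hN M h1).trans (le_max_right _ _)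

end

section
open Matrix Quaternion
open scoped Matrix.Norms.L2Operator ComplexOrder

lemma hecke_pow (m n : ℕ) :
    hecke m ^ n = ∑ f : Fin n → Fin 6, rho m (unitWord (List.ofFn f)) := by
  induction n with
  | zero => simp [rho_one]
  | succ n ih =>
    rw [pow_succ', ih, ← (Fin.consEquiv fun _ => Fin 6).sum_comp, Fintype.sum_prod_type, hecke,
      Finset.sum_mul_sum]
    simp [List.ofFn_succ, rho_mul]

lemma norm_trace_le {k : ℕ} (A : Matrix (Fin k) (Fin k) ℂ) : ‖A.trace‖ ≤ k * ‖A‖ := by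
  rw [trace]
  refine (norm_sum_le _ _).trans ?_
  refine (Finset.sum_le_sum fun i _ => show ‖A.diag i‖ ≤ ‖A‖ from ?_).trans (by simp)
  have h := l2_opNorm_mulVec A (EuclideanSpace.single i 1)
  have h2 := PiLp.norm_apply_le (WithLp.toLp 2 (A *ᵥ (EuclideanSpace.single i (1 : ℂ)).ofLp)) i
  simpa using h2.trans h

lemma trace_hecke_pow (m n : ℕ) {q : ℍ[ℝ]} (hq : normSq q = 1) :
    (hecke m ^ n * rho m q).trace = ((∑ f : Fin n → Fin 6, (Polynomial.Chebyshev.U ℝ m).eval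
      (unitWord (List.ofFn f) * q).re : ℝ) : ℂ) := by
  rw [hecke_pow, Finset.sum_mul, trace_sum, Complex.ofReal_sum]
  refine Finset.sum_congr rfl fun f _ => ?_
  rw [← rho_mul, trace_rho]
  rw [map_mul, hq, normSq_unitWord, one_mul]

lemma le_sum_kerU {γ : ℝ} (hγ : ∀ M, 1 ≤ M → ‖hecke (2 * M)‖ ≤ 6 * γ) (M n : ℕ) {q : ℍ[ℝ]}
    (hq : normSq q = 1) : 6 ^ n * ((M + 1) - (M + 1) ^ 4 * γ ^ n) ≤
      ∑ f : Fin n → Fin 6, kerU M (unitWord (List.ofFn f) * q).re := by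
  set t : ℕ → ℝ := fun m => ∑ f : Fin n → Fin 6, (Polynomial.Chebyshev.U ℝ (2 * m : ℕ)).eval
      (unitWord (List.ofFn f) * q).re with ht
  have hγ0 : 0 ≤ γ := by have := (norm_nonneg _).trans (hγ 1 le_rfl); linarith
  have hsum : ∑ f : Fin n → Fin 6, kerU M (unitWord (List.ofFn f) * q).re =
      ∑ m ∈ Finset.range (2 * M + 1), (coeffU M m : ℝ) * t m := by
    simp only [kerU_eq_sum, ht, Finset.mul_sum]
    exact Finset.sum_comm
  have h0 : t 0 = 6 ^ n := by simp [ht]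
  have hm : ∀ m, -((2 * (m + 1 : ℕ) + 1) * (6 * γ) ^ n) ≤ t (m + 1) := by
    intro m
    have h1 := norm_trace_le (hecke (2 * (m + 1)) ^ n * rho (2 * (m + 1)) q)
    rw [trace_hecke_pow _ _ hq, Complex.norm_real, Real.norm_eq_abs] at h1
    have h2 : ‖hecke (2 * (m + 1)) ^ n * rho (2 * (m + 1)) q‖ ≤ (6 * γ) ^ n := by
      refine (norm_mul_le _ _).trans ?_
      rw [norm_rho _ hq, mul_one]
      refine (norm_pow_le _ _).trans ?_
      gcongr
      exact hγ _ (by omega)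
    have h3 := (abs_le.1 (h1.trans (mul_le_mul_of_nonneg_left h2 (by positivity)))).1
    push_cast at h3 ⊢
    exact h3
  rw [hsum, Finset.sum_range_succ', h0, coeffU_zero]
  have hc := sum_coeffU M
  rw [Finset.sum_range_succ', coeffU_zero] at hc
  have h4 : ∑ m ∈ Finset.range (2 * M), (coeffU M (m + 1) : ℝ) *
      -((2 * (m + 1 : ℕ) + 1) * (6 * γ) ^ n) ≤
      ∑ m ∈ Finset.range (2 * M), (coeffU M (m + 1) : ℝ) * t (m + 1) :=
    Finset.sum_le_sum fun m _ => mul_le_mul_of_nonneg_left (hm m) (by positivity)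
  have h5 : ∑ m ∈ Finset.range (2 * M), (coeffU M (m + 1) : ℝ) *
      -((2 * (m + 1 : ℕ) + 1) * (6 * γ) ^ n) = -((M + 1) ^ 4 - (M + 1)) * (6 * γ) ^ n := by
    have : ∑ m ∈ Finset.range (2 * M), (coeffU M (m + 1) : ℝ) * (2 * (m + 1 : ℕ) + 1) =
        (M + 1) ^ 4 - (M + 1) := by
      rw [← hc]; push_cast; ring
    rw [← this, ← Finset.sum_neg_distrib, Finset.sum_mul]
    exact Finset.sum_congr rfl fun m _ => by ring
  rw [h5, mul_pow] at h4
  have h6 : 0 ≤ ((M : ℝ) + 1) * (6 ^ n * γ ^ n) := by positivity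
  push_cast
  linarith

lemma exists_le_kerU {γ : ℝ} (hγ : ∀ M, 1 ≤ M → ‖hecke (2 * M)‖ ≤ 6 * γ) (M n : ℕ) {q : ℍ[ℝ]}
    (hq : normSq q = 1) : ∃ w : List (Fin 6), w.length = n ∧
      (M + 1) - (M + 1) ^ 4 * γ ^ n ≤ kerU M (unitWord w * q).re := by
  by_contra! h
  have h1 := le_sum_kerU hγ M n hq
  refine absurd h1 (not_le.2 ?_)
  calc ∑ f : Fin n → Fin 6, kerU M (unitWord (List.ofFn f) * q).re
      < ∑ _f : Fin n → Fin 6, (((M : ℝ) + 1) - (M + 1) ^ 4 * γ ^ n) :=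
        Finset.sum_lt_sum_of_nonempty Finset.univ_nonempty fun f _ =>
          h _ (List.length_ofFn)
    _ = _ := by simp; ring

lemma abs_re_le_one {q : ℍ[ℝ]} (hq : normSq q = 1) : |q.re| ≤ 1 := by
  rw [normSq_def'] at hq
  rw [← sq_le_one_iff_abs_le_one]
  nlinarith [sq_nonneg q.imI, sq_nonneg q.imJ, sq_nonneg q.imK]

lemma exists_re_sq_ge : ∃ K : ℝ, 0 < K ∧ ∀ δ : ℝ, 0 < δ → δ ≤ 1 / 2 → ∀ n : ℕ,
    K * -Real.log δ ≤ n → ∀ q : ℍ[ℝ], normSq q = 1 → ∃ w : List (Fin 6), w.length = n ∧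
      1 - (unitWord w * q).re ^ 2 ≤ δ ^ 2 := by
  obtain ⟨γ, h0, h1, hγ⟩ := exists_gap
  have hlog : 0 < -Real.log γ := neg_pos.2 (Real.log_neg h0 h1)
  refine ⟨19 / -Real.log γ, by positivity, fun δ hδ hδ2 n hn q hq => ?_⟩
  set M := ⌈2 / δ ^ 4⌉₊ with hM
  have hM1 : 2 / δ ^ 4 ≤ M := Nat.le_ceil _
  have hM2 : (M : ℝ) < 2 / δ ^ 4 + 1 := Nat.ceil_lt_add_one (by positivity)
  have hδ4 : δ ^ 4 ≤ 1 := pow_le_one₀ hδ.le (by linarith)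
  have hM3 : (M : ℝ) + 1 ≤ 4 / δ ^ 4 := by
    have : 1 ≤ 1 / δ ^ 4 := by rwa [le_div_iff₀ (by positivity), one_mul]
    have e : 4 / δ ^ 4 = 2 / δ ^ 4 + 2 * (1 / δ ^ 4) := by ring
    linarith
  have hγn : γ ^ n ≤ δ ^ 19 := by
    rw [← Real.log_le_log_iff (by positivity) (by positivity), Real.log_pow, Real.log_pow]
    rw [div_mul_eq_mul_div, div_le_iff₀ hlog] at hn
    push_cast
    linarith
  have hsmall : ((M : ℝ) + 1) ^ 3 * γ ^ n ≤ 1 / 2 := by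
    calc ((M : ℝ) + 1) ^ 3 * γ ^ n ≤ (4 / δ ^ 4) ^ 3 * δ ^ 19 := by gcongr
      _ = 64 * δ ^ 7 := by field_simp; norm_num
      _ ≤ 64 * (1 / 2) ^ 7 := by gcongr
      _ ≤ 1 / 2 := by norm_num
  obtain ⟨w, hw, hk⟩ := exists_le_kerU hγ M n hq
  refine ⟨w, hw, ?_⟩
  set x := (unitWord w * q).re with hx
  have hx1 : |x| ≤ 1 := abs_re_le_one (by rw [map_mul, hq, normSq_unitWord, one_mul])
  have h2 := kerU_mul_le (M := M) hx1
  have hk2 : ((M : ℝ) + 1) / 2 ≤ kerU M x := by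
    refine le_trans ?_ hk
    have : ((M : ℝ) + 1) ^ 4 * γ ^ n = (M + 1) * ((M + 1) ^ 3 * γ ^ n) := by ring
    rw [this]
    nlinarith
  have hk3 : 1 / δ ^ 4 ≤ kerU M x := by
    have : 1 / δ ^ 4 = (2 / δ ^ 4) / 2 := by ring
    rw [this]
    linarith
  have h3 : (1 - x ^ 2) ^ 2 ≤ (δ ^ 2) ^ 2 := by
    have h4 : 1 / δ ^ 4 * (1 - x ^ 2) ^ 2 ≤ 1 := (mul_le_mul_of_nonneg_right hk3 (sq_nonneg _)).trans h2
    rw [div_mul_eq_mul_div, one_mul, div_le_one (by positivity)] at h4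
    linarith [h4, show (δ ^ 2) ^ 2 = δ ^ 4 by ring]
  exact (abs_le_of_sq_le_sq' h3 (by positivity)).2

lemma norm_conj_sub_le {r v : ℍ[ℝ]} (hr : normSq r = 1) {δ : ℝ} (hδ : 0 ≤ δ)
    (h : 1 - r.re ^ 2 ≤ δ ^ 2) : ‖r * v * star r - v‖ ≤ 2 * δ * ‖v‖ := by
  have hn : ‖star r‖ = 1 := by
    rw [norm_star, ← sq_eq_sq₀ (norm_nonneg _) zero_le_one, sq, ← normSq_eq_norm_mul_self, hr, one_pow]
  have h1 : r * v * star r - v = (r * v - v * r) * star r := by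
    rw [sub_mul, mul_assoc v, self_mul_star, hr]; simp
  have h2 : r * v - v * r = (r - (r.re : ℍ[ℝ])) * v - v * (r - (r.re : ℍ[ℝ])) := by
    rw [sub_mul, mul_sub, Quaternion.coe_commutes]; abel
  have h3 : ‖r - (r.re : ℍ[ℝ])‖ ≤ δ := by
    refine abs_le_of_sq_le_sq' ?_ hδ |>.2
    rw [sq, ← normSq_eq_norm_mul_self, normSq_def']
    rw [normSq_def'] at hr
    simp only [re_sub, imI_sub, imJ_sub, imK_sub, re_coe, imI_coe, imJ_coe, imK_coe]
    nlinarith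
  rw [h1, norm_mul, hn, mul_one, h2]
  refine (norm_sub_le _ _).trans ?_
  rw [norm_mul, norm_mul]
  nlinarith [norm_nonneg v]

/-- Words in the six generators of logarithmic length are dense in the rotation group. -/
lemma exists_word_conj_near : ∃ K : ℝ, 0 < K ∧ ∀ δ : ℝ, 0 < δ → δ ≤ 1 / 2 → ∀ n : ℕ,
    K * -Real.log δ ≤ n → ∀ q : ℍ[ℝ], normSq q = 1 → ∃ w : List (Fin 6), w.length = n ∧
      ∀ v : ℍ[ℝ], ‖unitWord w * v * star (unitWord w) - q * v * star q‖ ≤ 2 * δ * ‖v‖ := by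
  obtain ⟨K, hK, h⟩ := exists_re_sq_ge
  refine ⟨K, hK, fun δ hδ hδ2 n hn q hq => ?_⟩
  obtain ⟨w, hw, h1⟩ := h δ hδ hδ2 n hn (star q) (by rw [normSq_star, hq])
  refine ⟨w, hw, fun v => ?_⟩
  have hr : normSq (unitWord w * star q) = 1 := by
    rw [map_mul, normSq_star, hq, normSq_unitWord, one_mul]
  have h2 := norm_conj_sub_le (v := q * v * star q) hr hδ.le h1
  have hsq : star q * q = 1 := by rw [star_mul_self, hq]; rfl
  have hn : ‖q‖ = 1 := by
    rw [← sq_eq_sq₀ (norm_nonneg _) zero_le_one, sq, ← normSq_eq_norm_mul_self, hq, one_pow]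
  have h3 : unitWord w * star q * (q * v * star q) * star (unitWord w * star q) =
      unitWord w * v * star (unitWord w) := by
    rw [star_mul, star_star]
    calc unitWord w * star q * (q * v * star q) * (q * star (unitWord w))
        = unitWord w * (star q * q) * v * (star q * q) * star (unitWord w) := by noncomm_ring
      _ = _ := by rw [hsq]; simp
  rwa [h3, norm_mul, norm_mul, norm_star, hn, one_mul, mul_one] at h2

end

section
open Quaternion

/-- The Euclidean norm on `Fin d → ℝ`. -/
noncomputable def enorm2 {d : ℕ} (x : Fin d → ℝ) : ℝ := ‖WithLp.toLp 2 x‖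

variable {d : ℕ}

lemma enorm2_sq (x : Fin d → ℝ) : enorm2 x ^ 2 = ∑ i, x i ^ 2 := by
  rw [enorm2, EuclideanSpace.norm_sq_eq]; simp

lemma enorm2_nonneg (x : Fin d → ℝ) : 0 ≤ enorm2 x := norm_nonneg _

lemma enorm2_eq_sqrt (x : Fin d → ℝ) : enorm2 x = √(∑ i, x i ^ 2) := by
  rw [← enorm2_sq, Real.sqrt_sq (enorm2_nonneg x)]

lemma enorm2_add_le (x y : Fin d → ℝ) : enorm2 (x + y) ≤ enorm2 x + enorm2 y := norm_add_le _ _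

lemma enorm2_smul (c : ℝ) (x : Fin d → ℝ) : enorm2 (c • x) = |c| * enorm2 x := by
  rw [enorm2, WithLp.toLp_smul, norm_smul]; rfl

lemma abs_apply_le_enorm2 (x : Fin d → ℝ) (i : Fin d) : |x i| ≤ enorm2 x :=
  PiLp.norm_apply_le (WithLp.toLp 2 x) i

lemma enorm2_pos {x : Fin d → ℝ} (hx : x ≠ 0) : 0 < enorm2 x := by
  rw [enorm2, norm_pos_iff]; simpa using hx

lemma euclDist_eq (x y : Fin d → ℝ) : √(∑ i, (x i - y i) ^ 2) = enorm2 (x - y) := by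
  rw [enorm2_eq_sqrt]; rfl

/-- The pure quaternion made of three coordinates. -/
def pureQ (e : Fin 3 ↪ Fin d) (x : Fin d → ℝ) : ℍ[ℝ] := mkQ 0 (x (e 0)) (x (e 1)) (x (e 2))

/-- Conjugation by `q` acting on three coordinates. -/
noncomputable def rot (e : Fin 3 ↪ Fin d) (q : ℍ[ℝ]) (x : Fin d → ℝ) (l : Fin d) : ℝ :=
  if l = e 0 then (q * pureQ e x * star q).imI else
  if l = e 1 then (q * pureQ e x * star q).imJ else
  if l = e 2 then (q * pureQ e x * star q).imK else x l

lemma rot_apply_zero (e : Fin 3 ↪ Fin d) (q : ℍ[ℝ]) (x : Fin d → ℝ) :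
    rot e q x (e 0) = (q * pureQ e x * star q).imI := by simp [rot]

lemma rot_apply_one (e : Fin 3 ↪ Fin d) (q : ℍ[ℝ]) (x : Fin d → ℝ) :
    rot e q x (e 1) = (q * pureQ e x * star q).imJ := by simp [rot]

lemma rot_apply_two (e : Fin 3 ↪ Fin d) (q : ℍ[ℝ]) (x : Fin d → ℝ) :
    rot e q x (e 2) = (q * pureQ e x * star q).imK := by simp [rot]

lemma rot_apply_of_ne (e : Fin 3 ↪ Fin d) (q : ℍ[ℝ]) (x : Fin d → ℝ) {l : Fin d}
    (h : ∀ i, l ≠ e i) : rot e q x l = x l := by simp [rot, h]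

lemma re_mul_pure_mul_star (q v : ℍ[ℝ]) (hv : v.re = 0) : (q * v * star q).re = 0 := by
  simp [hv]; ring

lemma pureQ_rot (e : Fin 3 ↪ Fin d) (q : ℍ[ℝ]) (x : Fin d → ℝ) :
    pureQ e (rot e q x) = q * pureQ e x * star q := by
  have h := re_mul_pure_mul_star q (pureQ e x) rfl
  apply QuaternionAlgebra.ext
  · exact h.symm
  · exact rot_apply_zero e q x
  · exact rot_apply_one e q x
  · exact rot_apply_two e q x

lemma sum_eq_sum_triple_add (e : Fin 3 ↪ Fin d) (f : Fin d → ℝ) :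
    ∑ l, f l = (f (e 0) + f (e 1) + f (e 2)) + ∑ l ∈ (Finset.univ.map e)ᶜ, f l := by
  rw [← Finset.sum_add_sum_compl (Finset.univ.map e), Finset.sum_map, Fin.sum_univ_three]

lemma mem_compl_map {e : Fin 3 ↪ Fin d} {l : Fin d} (h : l ∈ (Finset.univ.map e)ᶜ) (i : Fin 3) :
    l ≠ e i := by
  rintro rfl
  simp at h

lemma enorm2_sq_eq (e : Fin 3 ↪ Fin d) (x : Fin d → ℝ) :
    enorm2 x ^ 2 = normSq (pureQ e x) + ∑ l ∈ (Finset.univ.map e)ᶜ, x l ^ 2 := by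
  rw [enorm2_sq, sum_eq_sum_triple_add e, normSq_def']
  simp [pureQ]

lemma enorm2_rot (e : Fin 3 ↪ Fin d) {q : ℍ[ℝ]} (hq : normSq q = 1) (x : Fin d → ℝ) :
    enorm2 (rot e q x) = enorm2 x := by
  rw [← sq_eq_sq₀ (enorm2_nonneg _) (enorm2_nonneg _), enorm2_sq_eq e, enorm2_sq_eq e, pureQ_rot,
    map_mul, map_mul, normSq_star, hq, one_mul, mul_one]
  congr 1
  exact Finset.sum_congr rfl fun l hl => by rw [rot_apply_of_ne _ _ _ (mem_compl_map hl)]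

lemma rot_congr {e : Fin 3 ↪ Fin d} {x y : Fin d → ℝ} (h : pureQ e x = pureQ e y)
    (h' : ∀ l, (∀ i, l ≠ e i) → x l = y l) : x = y := by
  ext l
  by_cases hl : ∀ i, l ≠ e i
  · exact h' l hl
  · push Not at hl
    obtain ⟨i, rfl⟩ := hl
    fin_cases i
    · exact congrArg QuaternionAlgebra.imI h
    · exact congrArg QuaternionAlgebra.imJ h
    · exact congrArg QuaternionAlgebra.imK h

lemma pureQ_sub (e : Fin 3 ↪ Fin d) (x y : Fin d → ℝ) :
    pureQ e (x - y) = pureQ e x - pureQ e y := by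
  apply QuaternionAlgebra.ext <;> simp [pureQ]

lemma rot_sub (e : Fin 3 ↪ Fin d) (q : ℍ[ℝ]) (x y : Fin d → ℝ) :
    rot e q (x - y) = rot e q x - rot e q y := by
  apply rot_congr (e := e)
  · rw [pureQ_sub, pureQ_rot, pureQ_rot, pureQ_rot, pureQ_sub]; noncomm_ring
  · intro l hl
    rw [Pi.sub_apply, rot_apply_of_ne _ _ _ hl, rot_apply_of_ne _ _ _ hl, rot_apply_of_ne _ _ _ hl,
      Pi.sub_apply]

lemma rot_mul (e : Fin 3 ↪ Fin d) (p q : ℍ[ℝ]) (x : Fin d → ℝ) :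
    rot e (p * q) x = rot e p (rot e q x) := by
  apply rot_congr (e := e)
  · rw [pureQ_rot, pureQ_rot, pureQ_rot, star_mul]; noncomm_ring
  · intro l hl
    rw [rot_apply_of_ne _ _ _ hl, rot_apply_of_ne _ _ _ hl, rot_apply_of_ne _ _ _ hl]

lemma rot_one (e : Fin 3 ↪ Fin d) (x : Fin d → ℝ) : rot e 1 x = x := by
  apply rot_congr (e := e)
  · rw [pureQ_rot]; simp
  · intro l hl
    rw [rot_apply_of_ne _ _ _ hl]

lemma rot_zero (e : Fin 3 ↪ Fin d) (q : ℍ[ℝ]) : rot e q 0 = 0 := by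
  simpa using rot_sub e q 0 0

lemma enorm2_rot_sub_rot_le (e : Fin 3 ↪ Fin d) {p q : ℍ[ℝ]} {δ : ℝ} (hδ : 0 ≤ δ)
    (h : ∀ v : ℍ[ℝ], ‖p * v * star p - q * v * star q‖ ≤ δ * ‖v‖) (x : Fin d → ℝ) :
    enorm2 (rot e p x - rot e q x) ≤ δ * enorm2 x := by
  refine abs_le_of_sq_le_sq' ?_ (mul_nonneg hδ (enorm2_nonneg x)) |>.2
  rw [enorm2_sq_eq e, Finset.sum_eq_zero fun l hl => ?_, add_zero, pureQ_sub, pureQ_rot, pureQ_rot,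
    mul_pow, enorm2_sq_eq e, normSq_eq_norm_mul_self, normSq_eq_norm_mul_self, ← sq, ← sq, mul_add,
    ← mul_pow]
  · have : 0 ≤ δ ^ 2 * ∑ l ∈ (Finset.univ.map e)ᶜ, x l ^ 2 := by positivity
    have h2 := pow_le_pow_left₀ (norm_nonneg _) (h (pureQ e x)) 2
    linarith
  · rw [Pi.sub_apply, rot_apply_of_ne _ _ _ (mem_compl_map hl),
      rot_apply_of_ne _ _ _ (mem_compl_map hl), sub_self]
    simp

lemma exists_conj_eq (u : ℍ[ℝ]) (hu : u.re = 0) :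
    ∃ (q : ℍ[ℝ]) (t : ℝ), 0 ≤ t ∧ normSq q = 1 ∧ q * u * star q = mkQ 0 t 0 0 := by
  set t := √(u.imI ^ 2 + u.imJ ^ 2 + u.imK ^ 2) with ht
  have ht2 : t ^ 2 = u.imI ^ 2 + u.imJ ^ 2 + u.imK ^ 2 := Real.sq_sqrt (by positivity)
  set h : ℍ[ℝ] := mkQ (t + u.imI) 0 u.imK (-u.imJ) with hh
  by_cases h0 : h = 0
  · have hJ : u.imJ = 0 := by have := congrArg QuaternionAlgebra.imK h0; simpa [hh] using this
    have hK : u.imK = 0 := by have := congrArg QuaternionAlgebra.imJ h0; simpa [hh] using this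
    have hI : t + u.imI = 0 := by have := congrArg QuaternionAlgebra.re h0; simpa [hh] using this
    refine ⟨mkQ 0 0 1 0, t, Real.sqrt_nonneg _, by simp [normSq_def'], ?_⟩
    apply QuaternionAlgebra.ext <;> simp [hJ, hK, hu]
    linarith
  · have hcomm : h * u = mkQ 0 t 0 0 * h := by
      apply QuaternionAlgebra.ext <;> simp [hh, hu] <;> nlinarith
    have hpos : 0 < normSq h := lt_of_le_of_ne normSq_nonneg (Ne.symm (normSq_ne_zero.2 h0))
    set s := √(normSq h) with hs
    have hs2 : s * s = normSq h := Real.mul_self_sqrt hpos.le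
    have hs0 : s ≠ 0 := (Real.sqrt_pos.2 hpos).ne'
    have hss : s⁻¹ * s⁻¹ * normSq h = 1 := by rw [← hs2]; field_simp
    refine ⟨s⁻¹ • h, t, Real.sqrt_nonneg _, ?_, ?_⟩
    · rw [normSq_smul, sq, hss]
    · rw [Quaternion.star_smul, smul_mul_assoc, hcomm, smul_mul_smul_comm, mul_assoc, self_mul_star]
      rw [← Quaternion.coe_mul_eq_smul, Quaternion.coe_commutes, mul_assoc, ← Quaternion.coe_mul,
        mul_comm (normSq h), hss]
      simp

lemma exists_rot_eq (e : Fin 3 ↪ Fin d) (x : Fin d → ℝ) : ∃ q : ℍ[ℝ], normSq q = 1 ∧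
    0 ≤ rot e q x (e 0) ∧ rot e q x (e 1) = 0 ∧ rot e q x (e 2) = 0 := by
  obtain ⟨q, t, ht, hq, h⟩ := exists_conj_eq (pureQ e x) rfl
  refine ⟨q, hq, ?_, ?_, ?_⟩
  · rw [rot_apply_zero, h]; exact ht
  · rw [rot_apply_one, h]; rfl
  · rw [rot_apply_two, h]; rfl

/-- `y` is obtained from `x` by `n` successive rotations in coordinate triples. -/
inductive RotReach : ℕ → (Fin d → ℝ) → (Fin d → ℝ) → Prop
  | refl (x : Fin d → ℝ) : RotReach 0 x x
  | step {n : ℕ} {x y : Fin d → ℝ} (e : Fin 3 ↪ Fin d) {q : ℍ[ℝ]} (hq : normSq q = 1)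
      (h : RotReach n x y) : RotReach (n + 1) x (rot e q y)

lemma RotReach.enorm2_eq {n : ℕ} {x y : Fin d → ℝ} (h : RotReach n x y) :
    enorm2 y = enorm2 x := by
  induction h with
  | refl x => rfl
  | step e hq _ ih => rw [enorm2_rot e hq, ih]

lemma RotReach.trans {m n : ℕ} {x y z : Fin d → ℝ} (h : RotReach m x y) (h' : RotReach n y z) :
    RotReach (m + n) x z := by
  induction h' with
  | refl y => exact h
  | step e hq _ ih => exact (ih h).step e hq

lemma RotReach.symm {n : ℕ} {x y : Fin d → ℝ} (h : RotReach n x y) : RotReach n y x := by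
  induction h with
  | refl x => exact .refl x
  | @step n x y e q hq _ ih =>
    have h1 : RotReach 1 (rot e q y) y := by
      have := (RotReach.refl (rot e q y)).step e (q := star q) (by rw [normSq_star, hq])
      have h2 : rot e (star q) (rot e q y) = y := by
        rw [← rot_mul, star_mul_self, hq, coe_one, rot_one]
      rwa [h2] at this
    have := h1.trans ih
    rwa [add_comm] at this

lemma exists_triple (hd : 3 ≤ d) {m : ℕ} (hm : m < d) (hm0 : m ≠ 0) : ∃ e : Fin 3 ↪ Fin d,
    e 0 = ⟨0, by omega⟩ ∧ e 1 = ⟨m, hm⟩ := by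
  obtain ⟨k, hk, hk0, hkm⟩ : ∃ k, k < d ∧ k ≠ 0 ∧ k ≠ m := by
    by_cases h : m = 1
    · exact ⟨2, by omega, by omega, by omega⟩
    · exact ⟨1, by omega, by omega, by omega⟩
  refine ⟨⟨![⟨0, by omega⟩, ⟨m, hm⟩, ⟨k, hk⟩], ?_⟩, rfl, rfl⟩
  intro a b
  fin_cases a <;> fin_cases b <;> simp <;> omega

lemma exists_rotReach_zero_lt (hd : 3 ≤ d) (x : Fin d → ℝ) (m : ℕ) (hm : m ≤ d) :
    ∃ y, RotReach m x y ∧ (∀ l : Fin d, (l : ℕ) ≠ 0 → (l : ℕ) < m → y l = 0) ∧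
      (2 ≤ m → 0 ≤ y ⟨0, by omega⟩) := by
  induction m with
  | zero => exact ⟨x, .refl x, fun l _ h => absurd h (by omega), fun h => absurd h (by omega)⟩
  | succ m ih =>
    obtain ⟨y, h1, h2, -⟩ := ih (by omega)
    by_cases hm0 : m = 0
    · subst hm0
      obtain ⟨e, -⟩ := exists_triple hd (show 1 < d by omega) (by omega)
      refine ⟨_, h1.step e (q := 1) (by simp), fun l _ h => absurd h (by omega),
        fun h => absurd h (by omega)⟩
    · obtain ⟨e, he0, he1⟩ := exists_triple hd (show m < d by omega) hm0
      obtain ⟨q, hq, h3, h4, h5⟩ := exists_rot_eq e y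
      refine ⟨_, h1.step e hq, fun l hl hlm => ?_, fun _ => by rw [← he0]; exact h3⟩
      by_cases hle : ∀ i, l ≠ e i
      · rw [rot_apply_of_ne _ _ _ hle]
        refine h2 l hl (lt_of_le_of_ne (by omega) fun h => hle 1 ?_)
        rw [he1]; exact Fin.ext h
      · push Not at hle
        obtain ⟨i, rfl⟩ := hle
        fin_cases i
        · simp [he0] at hl
        · exact h4
        · exact h5

lemma rotReach_of_enorm2_eq (hd : 3 ≤ d) {x y : Fin d → ℝ} (h : enorm2 x = enorm2 y) :
    RotReach (2 * d) x y := by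
  obtain ⟨x', hx1, hx2, hx3⟩ := exists_rotReach_zero_lt hd x d le_rfl
  obtain ⟨y', hy1, hy2, hy3⟩ := exists_rotReach_zero_lt hd y d le_rfl
  have key : ∀ z : Fin d → ℝ, (∀ l : Fin d, (l : ℕ) ≠ 0 → (l : ℕ) < d → z l = 0) →
      (2 ≤ d → 0 ≤ z ⟨0, by omega⟩) → z ⟨0, by omega⟩ = enorm2 z := by
    intro z h1 h2
    rw [enorm2_eq_sqrt, Finset.sum_eq_single ⟨0, by omega⟩, Real.sqrt_sq (h2 (by omega))]
    · intro l _ hl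
      rw [h1 l (fun h => hl (Fin.ext h)) l.2]; simp
    · simp
  have hxy : x' = y' := by
    ext l
    by_cases hl : (l : ℕ) = 0
    · have : l = ⟨0, by omega⟩ := Fin.ext hl
      rw [this, key x' hx2 hx3, key y' hy2 hy3, hx1.enorm2_eq, hy1.enorm2_eq, h]
    · rw [hx2 l hl l.2, hy2 l hl l.2]
  subst hxy
  rw [two_mul]
  exact hx1.trans hy1.symm

/-- The action of words in the generators of the coordinate rotations. -/
noncomputable def act : List ((Fin 3 ↪ Fin d) × Fin 6) → (Fin d → ℝ) → Fin d → ℝ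
  | [], x => x
  | a :: w, x => rot a.1 (unitGen a.2) (act w x)

lemma act_append (w w' : List ((Fin 3 ↪ Fin d) × Fin 6)) (x : Fin d → ℝ) :
    act (w ++ w') x = act w (act w' x) := by
  induction w with
  | nil => rfl
  | cons a w ih => rw [List.cons_append, act, act, ih]

lemma act_map (e : Fin 3 ↪ Fin d) (w : List (Fin 6)) (x : Fin d → ℝ) :
    act (w.map (Prod.mk e)) x = rot e (unitWord w) x := by
  induction w with
  | nil => rw [unitWord_nil, rot_one]; rfl
  | cons a w ih => rw [List.map_cons, act, ih, unitWord_cons, rot_mul]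

lemma exists_act_near : ∃ K : ℝ, 0 < K ∧ ∀ δ : ℝ, 0 < δ → δ ≤ 1 / 2 → ∀ n : ℕ,
    K * -Real.log δ ≤ n → ∀ (L : ℕ) (x y : Fin d → ℝ), RotReach L x y →
      ∃ w : List ((Fin 3 ↪ Fin d) × Fin 6), w.length = n * L ∧
        enorm2 (act w x - y) ≤ L * (2 * δ * enorm2 x) := by
  obtain ⟨K, hK, h⟩ := exists_word_conj_near
  refine ⟨K, hK, fun δ hδ hδ2 n hn L x y hxy => ?_⟩
  induction hxy with
  | refl x => exact ⟨[], rfl, by simp [act, enorm2]⟩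
  | @step L x y e q hq hxy ih =>
    obtain ⟨w, hw, h1⟩ := ih
    obtain ⟨w', hw', h2⟩ := h δ hδ hδ2 n hn q hq
    refine ⟨w'.map (Prod.mk e) ++ w, by simp [hw, hw']; ring, ?_⟩
    rw [act_append, act_map]
    have h3 : rot e (unitWord w') (act w x) - rot e q y =
        rot e (unitWord w') (act w x - y) + (rot e (unitWord w') y - rot e q y) := by
      rw [rot_sub]; abel
    rw [h3]
    refine (enorm2_add_le _ _).trans ?_
    have h4 := enorm2_rot_sub_rot_le e (by positivity) h2 y
    rw [enorm2_rot e (normSq_unitWord w')]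
    rw [hxy.enorm2_eq] at h4
    push_cast
    linarith

end

/-- The index of the mesh cube containing a point. -/
noncomputable def meshIndex {d : ℕ} (δ : ℝ) (x : Fin d → ℝ) (i : Fin d) : ℤ := ⌊x i / δ⌋

lemma meshCount_eq {d : ℕ} {δ : ℝ} (hδ : 0 < δ) (E : Set (Fin d → ℝ)) :
    meshCount d δ E = (meshIndex δ '' E).ncard := by
  rw [meshCount]
  congr 1
  ext a
  simp only [Set.mem_ofPred_eq, Set.mem_image]
  refine exists_congr fun x => and_congr_right fun _ => ?_
  rw [funext_iff]
  refine forall_congr' fun i => ?_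
  rw [meshIndex, Int.floor_eq_iff, le_div_iff₀ hδ, div_lt_iff₀ hδ]

lemma meshIndex_image_subset {d : ℕ} {δ B : ℝ} (hδ : 0 < δ) {E : Set (Fin d → ℝ)}
    (hE : ∀ x ∈ E, ∀ i, |x i| ≤ B) : meshIndex δ '' E ⊆
      ↑(Fintype.piFinset fun _ : Fin d => Finset.Icc ⌊-B / δ⌋ ⌊B / δ⌋) := by
  rintro _ ⟨x, hx, rfl⟩
  rw [Finset.mem_coe, Fintype.mem_piFinset]
  intro i
  have h := abs_le.1 (hE x hx i)
  rw [Finset.mem_Icc, meshIndex]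
  exact ⟨Int.floor_le_floor (by gcongr; exact h.1), Int.floor_le_floor (by gcongr; exact h.2)⟩

lemma meshCount_le {d : ℕ} {δ B : ℝ} (hδ : 0 < δ) (hδ1 : δ ≤ 1) (hB : 1 ≤ B)
    {E : Set (Fin d → ℝ)} (hE : ∀ x ∈ E, ∀ i, |x i| ≤ B) :
    (meshCount d δ E : ℝ) ≤ (4 * B / δ) ^ d := by
  rw [meshCount_eq hδ]
  have h1 := Set.ncard_le_ncard (meshIndex_image_subset hδ hE) (Finset.finite_toSet _)
  rw [Set.ncard_coe_finset, Fintype.card_piFinset, Finset.prod_const, Finset.card_univ,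
    Fintype.card_fin, Int.card_Icc] at h1
  refine (Nat.cast_le.2 h1).trans ?_
  rw [Nat.cast_pow]
  gcongr
  have hBδ : 1 ≤ B / δ := by rw [le_div_iff₀ hδ]; linarith
  have h2 : (((⌊B / δ⌋ + 1 - ⌊-B / δ⌋).toNat : ℤ) : ℝ) = ⌊B / δ⌋ + 1 - ⌊-B / δ⌋ := by
    rw [Int.toNat_of_nonneg]
    · push_cast; rfl
    · have : ⌊-B / δ⌋ ≤ ⌊B / δ⌋ := Int.floor_le_floor (by gcongr; linarith)
      omega
  rw [Int.cast_natCast] at h2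
  rw [h2]
  have h3 := Int.floor_le (B / δ)
  have h4 := Int.lt_floor_add_one (-B / δ)
  have e1 : -B / δ = -(B / δ) := by ring
  have e2 : 4 * B / δ = 4 * (B / δ) := by ring
  rw [e2]
  rw [e1] at h4 ⊢
  linarith

lemma pow_le_meshCount {n : ℕ} {δ B C R : ℝ} (hδ : 0 < δ) (hC : 0 ≤ C) (hR : 0 ≤ R)
    {E : Set (Fin (n + 1) → ℝ)} (hE : ∀ x ∈ E, ∀ i, |x i| ≤ B)
    (h : ∀ y : Fin (n + 1) → ℝ, enorm2 y = R → ∃ z ∈ E, enorm2 (z - y) ≤ C * δ) :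
    ⌊R / ((2 * C + 3) * (n + 1) * δ)⌋₊ ^ n ≤ meshCount (n + 1) δ E := by
  set m := ⌊R / ((2 * C + 3) * (n + 1) * δ)⌋₊ with hm
  set s := (2 * C + 3) * δ with hs
  have hs0 : 0 < s := by positivity
  have hm1 : (m : ℝ) * s ≤ R / (n + 1) := by
    have := Nat.floor_le (show 0 ≤ R / ((2 * C + 3) * (n + 1) * δ) by positivity)
    rw [le_div_iff₀ (by positivity)] at this ⊢
    rw [hs]; linarith
  have hex : ∀ b : Fin n → Fin m, ∃ z ∈ E, ∀ i : Fin n, |z i.succ - s * (b i : ℕ)| ≤ C * δ := by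
    intro b
    have hsum : ∑ i, (s * (b i : ℕ)) ^ 2 ≤ R ^ 2 := by
      calc ∑ i, (s * (b i : ℕ)) ^ 2 ≤ ∑ _i : Fin n, (R / (n + 1)) ^ 2 := by
            refine Finset.sum_le_sum fun i _ => ?_
            have : ((b i : ℕ) : ℝ) ≤ m := by exact_mod_cast (b i).2.le
            refine pow_le_pow_left₀ (by positivity) (le_trans ?_ hm1) 2
            rw [mul_comm]; gcongr
        _ = n * (R / (n + 1)) ^ 2 := by simp
        _ ≤ (n + 1) ^ 2 * (R / (n + 1)) ^ 2 := by gcongr; nlinarith [n.cast_nonneg (α := ℝ)]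
        _ = R ^ 2 := by field_simp
    obtain ⟨z, hz, h1⟩ := h (Fin.cons (√(R ^ 2 - ∑ i, (s * (b i : ℕ)) ^ 2))
      fun i => s * (b i : ℕ)) (by
        rw [enorm2_eq_sqrt, Fin.sum_univ_succ]
        simp only [Fin.cons_zero, Fin.cons_succ]
        rw [Real.sq_sqrt (by linarith), sub_add_cancel, Real.sqrt_sq hR])
    refine ⟨z, hz, fun i => ?_⟩
    have h2 := (abs_apply_le_enorm2 _ i.succ).trans h1
    rwa [Pi.sub_apply, Fin.cons_succ] at h2
  choose f hf1 hf2 using hex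
  have hinj : Function.Injective fun b => meshIndex δ (f b) := by
    intro b b' hbb
    by_contra hne
    obtain ⟨i, hi⟩ := Function.ne_iff.1 hne
    have h1 := congrFun hbb i.succ
    simp only [meshIndex] at h1
    have h2 := Int.abs_sub_lt_one_of_floor_eq_floor h1
    rw [← sub_div, abs_div, abs_of_pos hδ, div_lt_one hδ] at h2
    have h3 : s ≤ |s * ((b i : ℕ) : ℝ) - s * ((b' i : ℕ) : ℝ)| := by
      rw [← mul_sub, abs_mul, abs_of_pos hs0]
      refine le_mul_of_one_le_right hs0.le ?_
      have h4 : ((b i : ℕ) : ℤ) - (b' i : ℕ) ≠ 0 := by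
        have : (b i : ℕ) ≠ (b' i : ℕ) := fun h => hi (Fin.ext h)
        omega
      exact_mod_cast Int.one_le_abs h4
    have h5 := hf2 b i
    have h6 := hf2 b' i
    rw [abs_le] at h5 h6
    rw [abs_lt] at h2
    rw [hs] at h3
    rcases le_abs.1 h3 with h7 | h7 <;> linarith
  rw [meshCount_eq hδ]
  have hfin : (meshIndex δ '' E).Finite :=
    (Finset.finite_toSet _).subset (meshIndex_image_subset hδ hE)
  calc m ^ n = (Set.range fun b => meshIndex δ (f b)).ncard := by
        rw [← Set.image_univ, Set.ncard_image_of_injective _ hinj, Set.ncard_univ]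
        simp
    _ ≤ _ := Set.ncard_le_ncard (by
        rintro _ ⟨b, rfl⟩
        exact ⟨f b, hf1 b, rfl⟩) hfin

lemma tendsto_neg_log : Tendsto (fun δ : ℝ => -Real.log δ) (nhdsWithin 0 (Set.Ioi 0)) atTop :=
  tendsto_neg_atBot_atTop.comp Real.tendsto_log_nhdsGT_zero

lemma le_lowerBoxDim {n : ℕ} {ε η A B C : ℝ} (hn : n * η ≤ ε / 2) (hη : η ≤ 1 / 2)
    (hε : 0 < ε) (hη0 : 0 < η) (hA : 0 < A) (hC : 0 ≤ C) (hB : 1 ≤ B)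
    {E : Set (Fin (n + 1) → ℝ)} (hE : ∀ x ∈ E, ∀ i, |x i| ≤ B)
    (h : ∀ δ : ℝ, 0 < δ → δ ≤ 1 / 2 → ∃ R, A * δ ^ η ≤ R ∧
      ∀ y : Fin (n + 1) → ℝ, enorm2 y = R → ∃ z ∈ E, enorm2 (z - y) ≤ C * δ) :
    (n : ℝ) - ε ≤ lowerBoxDim (n + 1) E := by
  set A' := A / ((2 * C + 3) * (n + 1)) with hA'
  have hA'0 : 0 < A' := by positivity
  have hsmall : ∀ᶠ δ : ℝ in nhdsWithin 0 (Set.Ioi 0), 0 < δ ∧ δ ≤ 1 / 2 := by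
    have := Ioc_mem_nhdsGT (show (0 : ℝ) < 1 / 2 by norm_num)
    exact this
  refine le_liminf_of_le ?_ ?_
  · refine IsBoundedUnder.isCoboundedUnder_ge ⟨(n + 1 : ℕ) * (Real.log (4 * B) + 1), ?_⟩
    rw [eventually_map]
    filter_upwards [hsmall, tendsto_neg_log.eventually_ge_atTop 1] with δ ⟨h0, h1⟩ h2
    have hlB : 0 ≤ Real.log (4 * B) := Real.log_nonneg (by linarith)
    rw [div_le_iff₀ (by linarith)]
    have h3 := meshCount_le h0 (by linarith) hB hE
    rcases Nat.eq_zero_or_pos (meshCount (n + 1) δ E) with h4 | h4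
    · rw [h4, Nat.cast_zero, Real.log_zero]; positivity
    · have h5 := Real.log_le_log (by exact_mod_cast h4) h3
      rw [Real.log_pow, Real.log_div (by positivity) h0.ne'] at h5
      refine h5.trans ?_
      rw [mul_assoc]
      gcongr
      nlinarith
  · filter_upwards [hsmall, tendsto_neg_log.eventually_ge_atTop 1,
      tendsto_neg_log.eventually_ge_atTop (2 * |Real.log A'|),
      tendsto_neg_log.eventually_ge_atTop (2 * (n * |Real.log (A' / 2)|) / ε)]
      with δ ⟨h0, h1⟩ h2 h3 h4
    obtain ⟨R, hR, hy⟩ := h δ h0 h1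
    have hR0 : 0 ≤ R := le_trans (by positivity) hR
    have hcount := pow_le_meshCount h0 hC hR0 hE hy
    set t := R / ((2 * C + 3) * (n + 1) * δ) with ht
    have ht1 : A' * δ ^ (η - 1) ≤ t := by
      rw [Real.rpow_sub_one h0.ne', ht, hA', div_mul_div_comm]
      gcongr
    have hlog : Real.log (A' * δ ^ (η - 1)) = Real.log A' + (1 - η) * -Real.log δ := by
      rw [Real.log_mul hA'0.ne' (by positivity), Real.log_rpow h0]; ring
    have ht2 : 1 ≤ A' * δ ^ (η - 1) := by
      rw [← Real.log_nonneg_iff (by positivity), hlog]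
      have := neg_abs_le (Real.log A')
      nlinarith
    have ht3 : t / 2 ≤ ⌊t⌋₊ := by
      have h5 := Nat.lt_floor_add_one t
      have h6 : (1 : ℝ) ≤ ⌊t⌋₊ := by
        exact_mod_cast (Nat.one_le_floor_iff t).2 (ht2.trans ht1)
      linarith
    have h7 : A' / 2 * δ ^ (η - 1) ≤ ⌊t⌋₊ := by linarith
    have h8 : (A' / 2 * δ ^ (η - 1)) ^ n ≤ meshCount (n + 1) δ E := by
      refine (pow_le_pow_left₀ (by positivity) h7 n).trans ?_
      exact_mod_cast hcount
    have h9 := Real.log_le_log (by positivity) h8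
    rw [Real.log_pow, Real.log_mul (by positivity) (by positivity), Real.log_rpow h0] at h9
    rw [le_div_iff₀ (by linarith)]
    refine le_trans ?_ h9
    rw [div_le_iff₀ hε] at h4
    have h10 := neg_abs_le (Real.log (A' / 2))
    have h11 : -(n * |Real.log (A' / 2)|) ≤ n * Real.log (A' / 2) := by
      rw [← mul_neg]; gcongr
    have h12 : n * η * -Real.log δ ≤ ε / 2 * -Real.log δ := by gcongr
    nlinarith

lemma rot_smul {d : ℕ} (e : Fin 3 ↪ Fin d) (q : Quaternion ℝ) (c : ℝ) (x : Fin d → ℝ) :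
    rot e q (c • x) = c • rot e q x := by
  have h : pureQ e (c • x) = c • pureQ e x := by
    apply QuaternionAlgebra.ext <;> simp [pureQ]
  ext l
  simp only [rot, h, Pi.smul_apply, smul_eq_mul, mul_smul_comm, smul_mul_assoc]
  split_ifs <;> simp

lemma smul_act_mem {d : ℕ} {c : ℝ} {x : Fin d → ℝ} {F : Set (Fin d → ℝ)} (hx : x ∈ F)
    (hF : ∀ a : (Fin 3 ↪ Fin d) × Fin 6, ∀ y ∈ F, c • rot a.1 (unitGen a.2) y ∈ F)
    (w : List ((Fin 3 ↪ Fin d) × Fin 6)) : c ^ w.length • act w x ∈ F := by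
  induction w with
  | nil => simpa [act] using hx
  | cons a w ih =>
    rw [act, List.length_cons, pow_succ', mul_smul, ← rot_smul]
    exact hF a _ ih

/-- For `d ≥ 3` and every `ε > 0` there is a finite IFS of contracting similarities on
`ℝ^d` whose attractor is a singleton `{p}` (i.e. all the maps fix `p`), but such that for
every singleton condensation set `{x}` with `x ≠ p`, the inhomogeneous attractor `F_C`
(the unique nonempty compact set with `F = ⋃ᵢ Sᵢ(F) ∪ {x}`) has lower box dimension at
least `d - 1 - ε`. -/
theorem large_inhomogeneous_attractor (d : ℕ) (hd : 3 ≤ d) (ε : ℝ) (hε : 0 < ε) :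
    ∃ (k : ℕ) (S : Fin k → (Fin d → ℝ) → (Fin d → ℝ)) (c : Fin k → ℝ),
      0 < k ∧
      (∀ i, 0 < c i ∧ c i < 1) ∧
      (∀ i x y, euclDist d (S i x) (S i y) = c i * euclDist d x y) ∧
      ∃ p : Fin d → ℝ, (∀ i, S i p = p) ∧
        ∀ x : Fin d → ℝ, x ≠ p →
          ∀ F : Set (Fin d → ℝ), F.Nonempty → IsCompact F →
            F = (⋃ i, S i '' F) ∪ {x} →
            (d : ℝ) - 1 - ε ≤ lowerBoxDim d F := by
  obtain ⟨K, hK, hnear⟩ := exists_act_near (d := d)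
  obtain ⟨n, rfl⟩ : ∃ n, d = n + 1 := ⟨d - 1, by omega⟩
  have hn0 : (0 : ℝ) < n := by exact_mod_cast (show 0 < n by omega)
  set η : ℝ := min (1 / 2) (ε / (2 * n)) with hη
  have hη0 : 0 < η := by rw [hη]; positivity
  set L : ℕ := 2 * (n + 1) with hL
  have hL0 : (0 : ℝ) < L := by rw [hL]; positivity
  set c : ℝ := Real.exp (-(η / (L * K))) with hc
  have hc0 : 0 < c := Real.exp_pos _
  have hc1 : c < 1 := Real.exp_lt_one_iff.2 (by rw [neg_lt_zero]; positivity)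
  let φ := Fintype.equivFin ((Fin 3 ↪ Fin (n + 1)) × Fin 6)
  refine ⟨_, fun i x => c • rot (φ.symm i).1 (unitGen (φ.symm i).2) x, fun _ => c, ?_,
    fun _ => ⟨hc0, hc1⟩, fun i x y => ?_, 0, fun i => ?_, fun x hx F _ hF hFx => ?_⟩
  · exact Fintype.card_pos_iff.2 ⟨((exists_triple hd (show 1 < n + 1 by omega) (by omega)).choose, 0)⟩
  · rw [euclDist, euclDist, euclDist_eq, euclDist_eq, ← smul_sub, ← rot_sub, enorm2_smul,
      enorm2_rot _ (normSq_unitGen _), abs_of_pos hc0]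
  · beta_reduce
    rw [rot_zero, smul_zero]
  have hxF : x ∈ F := by rw [hFx]; exact Or.inr rfl
  have hmem := smul_act_mem (c := c) hxF fun a y hy => by
    rw [hFx]
    refine Or.inl (Set.mem_iUnion.2 ⟨φ a, y, hy, ?_⟩)
    simp
  obtain ⟨B, hB⟩ := hF.isBounded.exists_norm_le
  have hx0 := enorm2_pos hx
  have hgoal : (((n + 1 : ℕ) : ℝ) - 1 - ε) = n - ε := by push_cast; ring
  rw [hgoal]
  refine le_lowerBoxDim (η := η) (A := Real.exp (-(η / K)) * enorm2 x) (B := max 1 B)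
    (C := 2 * L * enorm2 x) ?_ (min_le_left _ _) hε hη0 (by positivity) (by positivity)
    (le_max_left _ _) (fun y hy i => ?_) fun δ hδ hδ2 => ?_
  · calc n * η ≤ n * (ε / (2 * n)) := by gcongr; exact min_le_right _ _
      _ = ε / 2 := by field_simp
  · exact (norm_le_pi_norm y i).trans ((hB y hy).trans (le_max_right _ _))
  · have hlog : 0 ≤ -Real.log δ := neg_nonneg.2 (Real.log_nonpos hδ.le (by linarith))
    set N := ⌈K * -Real.log δ⌉₊ with hN
    have hN1 : K * -Real.log δ ≤ N := Nat.le_ceil _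
    have hN2 : (N : ℝ) < K * -Real.log δ + 1 := Nat.ceil_lt_add_one (by positivity)
    have hcp : 0 < c ^ (N * L) := by positivity
    refine ⟨c ^ (N * L) * enorm2 x, ?_, fun y hy => ?_⟩
    · rw [mul_right_comm]
      gcongr
      rw [hc, ← Real.exp_nat_mul, Real.rpow_def_of_pos hδ, ← Real.exp_add, Real.exp_le_exp]
      have e : ((N * L : ℕ) : ℝ) * -(η / (L * K)) = -(η / K) * N := by
        push_cast; field_simp
      rw [e]
      have : η / K * N ≤ η / K * (K * -Real.log δ + 1) := by gcongr
      have e2 : η / K * (K * -Real.log δ + 1) = η * -Real.log δ + η / K := by field_simp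
      linarith
    · have hreach : RotReach L x ((c ^ (N * L))⁻¹ • y) := by
        refine rotReach_of_enorm2_eq hd ?_
        rw [enorm2_smul, hy, abs_of_pos (inv_pos.2 hcp), inv_mul_cancel_left₀ hcp.ne']
      obtain ⟨w, hw, h1⟩ := hnear δ hδ hδ2 N hN1 L x _ hreach
      refine ⟨_, hmem w, ?_⟩
      have h2 : c ^ w.length • act w x - y =
          c ^ (N * L) • (act w x - (c ^ (N * L))⁻¹ • y) := by
        rw [hw, smul_sub, smul_inv_smul₀ hcp.ne']
      rw [h2, enorm2_smul, abs_of_pos hcp]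
      calc c ^ (N * L) * enorm2 (act w x - (c ^ (N * L))⁻¹ • y)
          ≤ 1 * enorm2 (act w x - (c ^ (N * L))⁻¹ • y) := by
            gcongr
            · exact enorm2_nonneg _
            · exact pow_le_one₀ hc0.le hc1.le
        _ ≤ _ := by rw [one_mul]; linarith
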